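/- arXiv:1007.0677 — 3 statements merged into one kernel-verified Lean document; each statement's English description precedes it below -/
import Mathlib

section
/- (Talagrand's variance bound, Theorem 1.5 of Talagrand 1994.) There exists a universal constant K > 0 such that for every p ∈ (0,1), every n ∈ ℕ, and every real-valued function f on ({0,1}ⁿ, μ_p), Var(f) ≤ K · log(2/(p(1−p))) · ∑_{i=1}^{n} ‖Δ_i f‖₂² / log(e‖Δ_i f‖₂/‖Δ_i f‖₁), where a summand is interpreted as 0 when Δ_i f is identically 0. -/
noncomputable section

namespace Talagrand1994

/-- The marginal measure on `{0,1}` (modelled as `Bool`) giving probability `p` to `1`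
(`true`) and `1 - p` to `0` (`false`). -/
def W (p : ℝ) : Bool → ℝ := fun b => if b then p else 1 - p

/-- The product measure `μ_p` on `{0,1}ⁿ`, as a weight function. -/
def prodW (p : ℝ) {n : ℕ} (x : Fin n → Bool) : ℝ := ∏ i, W p (x i)

/-- The influence operator
`Δᵢ f x = f x - ∫ f(x₁,…,x_{i-1},ξ,x_{i+1},…,x_n) dμ(ξ)`. -/
def Δ (p : ℝ) {n : ℕ} (f : (Fin n → Bool) → ℝ) (i : Fin n) (x : Fin n → Bool) : ℝ :=
  f x - ∑ ξ : Bool, W p ξ * f (Function.update x i ξ)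

/-- The `L^q(μ_p)` norm of a function on `{0,1}ⁿ`. -/
def lpNorm (p : ℝ) {n : ℕ} (q : ℝ) (g : (Fin n → Bool) → ℝ) : ℝ :=
  (∑ x, prodW p x * |g x| ^ q) ^ (1 / q)

/-- The variance `Var(f) = ∫ |f - ∫ f dμ_p|² dμ_p`. -/
def var (p : ℝ) {n : ℕ} (f : (Fin n → Bool) → ℝ) : ℝ :=
  ∑ x, prodW p x * |f x - ∑ x', prodW p x' * f x'| ^ 2

lemma sum_W (p : ℝ) : ∑ b, W p b = 1 := by
  simp [W]

lemma W_pos {p : ℝ} (hp : p ∈ Set.Ioo (0 : ℝ) 1) (b : Bool) : 0 < W p b := by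
  cases b
  · simpa [W] using hp.2
  · simpa [W] using hp.1

lemma prodW_pos {p : ℝ} (hp : p ∈ Set.Ioo (0 : ℝ) 1) {n : ℕ} (x : Fin n → Bool) :
    0 < prodW p x :=
  Finset.prod_pos fun i _ => W_pos hp (x i)

/-- Expectation with respect to `μ_p`. -/
def expect (p : ℝ) {n : ℕ} (f : (Fin n → Bool) → ℝ) : ℝ := ∑ x, prodW p x * f x

lemma expect_mono {p : ℝ} (hp : p ∈ Set.Ioo (0 : ℝ) 1) {n : ℕ} {f g : (Fin n → Bool) → ℝ}
    (h : ∀ x, f x ≤ g x) : expect p f ≤ expect p g :=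
  Finset.sum_le_sum fun x _ => mul_le_mul_of_nonneg_left (h x) (prodW_pos hp x).le

lemma expect_nonneg {p : ℝ} (hp : p ∈ Set.Ioo (0 : ℝ) 1) {n : ℕ} {f : (Fin n → Bool) → ℝ}
    (h : ∀ x, 0 ≤ f x) : 0 ≤ expect p f :=
  Finset.sum_nonneg fun x _ => mul_nonneg (prodW_pos hp x).le (h x)

lemma expect_pos {p : ℝ} (hp : p ∈ Set.Ioo (0 : ℝ) 1) {n : ℕ} {f : (Fin n → Bool) → ℝ}
    (h : ∀ x, 0 ≤ f x) {x : Fin n → Bool} (hx : 0 < f x) : 0 < expect p f :=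
  Finset.sum_pos' (fun y _ => mul_nonneg (prodW_pos hp y).le (h y))
    ⟨x, Finset.mem_univ _, mul_pos (prodW_pos hp x) hx⟩

lemma expect_add (p : ℝ) {n : ℕ} (f g : (Fin n → Bool) → ℝ) :
    expect p (fun x => f x + g x) = expect p f + expect p g := by
  simp [expect, mul_add, Finset.sum_add_distrib]

lemma expect_sub (p : ℝ) {n : ℕ} (f g : (Fin n → Bool) → ℝ) :
    expect p (fun x => f x - g x) = expect p f - expect p g := by
  simp [expect, mul_sub, Finset.sum_sub_distrib]

lemma expect_const_mul (p : ℝ) {n : ℕ} (c : ℝ) (f : (Fin n → Bool) → ℝ) :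
    expect p (fun x => c * f x) = c * expect p f := by
  simp only [expect, Finset.mul_sum]
  exact Finset.sum_congr rfl fun x _ => by ring

lemma expect_sum (p : ℝ) {n : ℕ} {κ : Type*} (s : Finset κ) (f : κ → (Fin n → Bool) → ℝ) :
    expect p (fun x => ∑ k ∈ s, f k x) = ∑ k ∈ s, expect p (f k) := by
  simp only [expect, Finset.mul_sum]
  exact Finset.sum_comm

lemma expect_const (p : ℝ) {n : ℕ} (c : ℝ) : expect p (fun _ : Fin n → Bool => c) = c := by
  have h : ∑ x : Fin n → Bool, prodW p x = 1 := by
    simp only [prodW]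
    rw [← Fintype.prod_sum fun (_ : Fin n) b => W p b]
    simp [W]
  rw [expect, ← Finset.sum_mul, h, one_mul]

lemma expect_mul_sq_le {p : ℝ} (hp : p ∈ Set.Ioo (0 : ℝ) 1) {n : ℕ}
    (f g : (Fin n → Bool) → ℝ) :
    expect p (fun x => f x * g x) ^ 2 ≤
      expect p (fun x => f x ^ 2) * expect p (fun x => g x ^ 2) := by
  have h := Finset.sum_mul_sq_le_sq_mul_sq Finset.univ
    (fun x => √(prodW p x) * f x) (fun x => √(prodW p x) * g x)
  have hs : ∀ x : Fin n → Bool, √(prodW p x) * √(prodW p x) = prodW p x :=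
    fun x => Real.mul_self_sqrt (prodW_pos hp x).le
  have e : ∀ (u v : (Fin n → Bool) → ℝ) x,
      √(prodW p x) * u x * (√(prodW p x) * v x) = prodW p x * (u x * v x) := fun u v x => by
    rw [mul_mul_mul_comm, hs]
  simpa only [expect, e, sq] using h

/-- Averaging over the `i`-th coordinate preserves the expectation. -/
lemma expect_average (p : ℝ) {n : ℕ} (i : Fin n) (f : (Fin n → Bool) → ℝ) :
    expect p (fun x => ∑ b, W p b * f (Function.update x i b)) = expect p f := by
  obtain _ | n := n
  · exact i.elim0
  have split : ∀ g : (Fin (n + 1) → Bool) → ℝ,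
      expect p g = ∑ y : Fin n → Bool, ∑ b, W p b * prodW p y * g (i.insertNth b y) := by
    intro g
    rw [expect, ← (Fin.insertNthEquiv (fun _ => Bool) i).sum_comp, Fintype.sum_prod_type_right]
    refine Finset.sum_congr rfl fun y _ => Finset.sum_congr rfl fun b _ => ?_
    simp [Fin.insertNthEquiv, prodW, Fin.prod_univ_succAbove _ i]
  rw [split, split]
  refine Finset.sum_congr rfl fun y _ => ?_
  simp only [Fin.update_insertNth, mul_assoc]
  rw [← Finset.sum_mul, sum_W, one_mul, Finset.mul_sum]
  exact Finset.sum_congr rfl fun b _ => by ring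

/-- The normalized character of a single biased bit. -/
def bitChar (p : ℝ) (b : Bool) : ℝ := (if b then 1 - p else -p) / √(p * (1 - p))

/-- The Fourier–Walsh basis of `L²(μ_p)`. -/
def walsh (p : ℝ) {n : ℕ} (S : Finset (Fin n)) (x : Fin n → Bool) : ℝ :=
  ∏ i ∈ S, bitChar p (x i)

/-- The Fourier–Walsh coefficients. -/
def coeff (p : ℝ) {n : ℕ} (f : (Fin n → Bool) → ℝ) (S : Finset (Fin n)) : ℝ :=
  expect p fun x => f x * walsh p S x

lemma sum_W_mul_bitChar (p : ℝ) : ∑ b, W p b * bitChar p b = 0 := by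
  simp [W, bitChar]
  ring

lemma one_add_bitChar_mul {p : ℝ} (hp : p ∈ Set.Ioo (0 : ℝ) 1) (a b : Bool) :
    W p a * (1 + bitChar p a * bitChar p b) = if a = b then 1 else 0 := by
  obtain ⟨h0, h1⟩ := hp
  have hq : 0 < 1 - p := by linarith
  have hs : √(p * (1 - p)) * √(p * (1 - p)) = p * (1 - p) :=
    Real.mul_self_sqrt (mul_pos h0 hq).le
  have e : bitChar p a * bitChar p b =
      (if a then 1 - p else -p) * (if b then 1 - p else -p) / (p * (1 - p)) := by
    rw [bitChar, bitChar, div_mul_div_comm, hs]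
  rw [e]
  cases a <;> cases b <;>
    simp only [W, if_true, if_false, Bool.false_eq_true, reduceCtorEq] <;> field_simp <;> ring

lemma prodW_mul_sum_walsh {p : ℝ} (hp : p ∈ Set.Ioo (0 : ℝ) 1) {n : ℕ} (x y : Fin n → Bool) :
    prodW p x * ∑ S, walsh p S x * walsh p S y = if x = y then 1 else 0 := by
  have h : ∑ S, walsh p S x * walsh p S y = ∏ i, (1 + bitChar p (x i) * bitChar p (y i)) := by
    rw [Finset.prod_one_add, Finset.powerset_univ]
    exact Finset.sum_congr rfl fun S _ => Finset.prod_mul_distrib.symm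
  rw [h, prodW, ← Finset.prod_mul_distrib]
  simp only [one_add_bitChar_mul hp]
  split_ifs with hxy
  · simp [hxy]
  · obtain ⟨i, hi⟩ := Function.ne_iff.mp hxy
    exact Finset.prod_eq_zero (Finset.mem_univ i) (if_neg hi)

lemma sum_coeff_sq {p : ℝ} (hp : p ∈ Set.Ioo (0 : ℝ) 1) {n : ℕ} (f : (Fin n → Bool) → ℝ) :
    ∑ S, coeff p f S ^ 2 = expect p (fun x => f x ^ 2) := by
  calc ∑ S, coeff p f S ^ 2
      = ∑ y, ∑ x, prodW p y * f y * f x *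
          (prodW p x * ∑ S, walsh p S x * walsh p S y) := by
        simp only [sq, coeff, expect, Finset.sum_mul, Finset.mul_sum]
        rw [Finset.sum_comm]
        refine Finset.sum_congr rfl fun y _ => ?_
        rw [Finset.sum_comm]
        exact Finset.sum_congr rfl fun x _ => Finset.sum_congr rfl fun S _ => by ring
    _ = _ := by
        simp only [prodW_mul_sum_walsh hp, expect]
        refine Finset.sum_congr rfl fun y _ => ?_
        simp
        ring

lemma coeff_empty (p : ℝ) {n : ℕ} (f : (Fin n → Bool) → ℝ) : coeff p f ∅ = expect p f := by
  simp [coeff, walsh]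

lemma walsh_update_of_notMem (p : ℝ) {n : ℕ} {S : Finset (Fin n)} {i : Fin n} (hi : i ∉ S)
    (x : Fin n → Bool) (b : Bool) : walsh p S (Function.update x i b) = walsh p S x :=
  Finset.prod_congr rfl fun j hj => by
    rw [Function.update_of_ne (ne_of_mem_of_not_mem hj hi)]

lemma walsh_insert (p : ℝ) {n : ℕ} {S : Finset (Fin n)} {i : Fin n} (hi : i ∉ S)
    (x : Fin n → Bool) : walsh p (insert i S) x = bitChar p (x i) * walsh p S x :=
  Finset.prod_insert hi

lemma coeff_Δ (p : ℝ) {n : ℕ} (f : (Fin n → Bool) → ℝ) (i : Fin n) (S : Finset (Fin n)) :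
    coeff p (Δ p f i) S = if i ∈ S then coeff p f S else 0 := by
  have h : coeff p (Δ p f i) S = coeff p f S -
      expect p (fun x => (∑ b, W p b * f (Function.update x i b)) * walsh p S x) := by
    rw [coeff, coeff, ← expect_sub]
    simp only [Δ, sub_mul]
  rw [h]
  split_ifs with hi
  · rw [sub_eq_self, ← expect_average p i]
    obtain ⟨T, hT, rfl⟩ : ∃ T, i ∉ T ∧ insert i T = S :=
      ⟨S.erase i, Finset.notMem_erase i S, Finset.insert_erase hi⟩
    have : ∀ x : Fin n → Bool, ∑ c, W p c *
        ((∑ b, W p b * f (Function.update (Function.update x i c) i b)) *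
          walsh p (insert i T) (Function.update x i c)) = 0 := by
      intro x
      calc _ = (∑ c, W p c * bitChar p c) *
            ((∑ b, W p b * f (Function.update x i b)) * walsh p T x) := by
            rw [Finset.sum_mul]
            refine Finset.sum_congr rfl fun c _ => ?_
            simp only [Function.update_idem, walsh_insert p hT, walsh_update_of_notMem p hT,
              Function.update_self]
            ring
        _ = 0 := by rw [sum_W_mul_bitChar, zero_mul]
    simp only [this, expect_const]
  · rw [sub_eq_zero, coeff, ← expect_average p i]
    congr 1
    funext x
    rw [Finset.sum_mul]
    exact Finset.sum_congr rfl fun b _ => by rw [walsh_update_of_notMem p hi, mul_assoc]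

/-- The two-point inequality underlying `(2,4)`-hypercontractivity. -/
lemma two_point_hypercontractive {p ρ : ℝ} (hp : p ∈ Set.Ioo (0 : ℝ) 1)
    (hρ : ρ ^ 2 = √(p * (1 - p)) / 2) (u v : ℝ) :
    ∑ b, W p b * (u + ρ * bitChar p b * v) ^ 4 ≤ (u ^ 2 + v ^ 2) ^ 2 := by
  obtain ⟨h0, h1⟩ := hp
  have hq : 0 < 1 - p := by linarith
  have hpq : 0 < p * (1 - p) := mul_pos h0 hq
  set s := √(p * (1 - p)) with hs
  have hs0 : 0 < s := Real.sqrt_pos.mpr hpq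
  have hs2 : s ^ 2 = p * (1 - p) := Real.sq_sqrt hpq.le
  have hs_half : s ≤ 1 / 2 := by nlinarith [sq_nonneg (2 * p - 1)]
  set w := ρ / s * v with hw
  have hw2 : s ^ 2 * w ^ 2 = s / 2 * v ^ 2 := by
    rw [hw, ← hρ]; field_simp
  have hw4 : s ^ 2 * w ^ 4 = v ^ 4 / 4 := by
    have : (s ^ 2 * w ^ 2) ^ 2 = (s / 2 * v ^ 2) ^ 2 := by rw [hw2]
    have h2 : s ^ 2 * (s ^ 2 * w ^ 4) = s ^ 2 * (v ^ 4 / 4) := by linear_combination this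
    exact mul_left_cancel₀ (pow_pos hs0 2).ne' h2
  have expand : ∑ b, W p b * (u + ρ * bitChar p b * v) ^ 4 =
      u ^ 4 + 6 * u ^ 2 * (s ^ 2 * w ^ 2) + 4 * (1 - 2 * p) * s ^ 2 * (u * w ^ 3) +
        (1 - 3 * (p * (1 - p))) * (s ^ 2 * w ^ 4) := by
    have e1 : ρ * ((1 - p) / s) * v = (1 - p) * w := by rw [hw]; ring
    have e2 : ρ * (-p / s) * v = -p * w := by rw [hw]; ring
    simp only [Fintype.sum_bool, W, bitChar, if_true, Bool.false_eq_true, if_false, ← hs]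
    rw [e1, e2, hs2]
    ring
  have cross : 4 * (1 - 2 * p) * s ^ 2 * (u * w ^ 3) ≤
      2 * u ^ 2 * (s ^ 2 * w ^ 2) + 2 * (1 - 2 * p) ^ 2 * (s ^ 2 * w ^ 4) := by
    nlinarith [sq_nonneg (s * w * (u - (1 - 2 * p) * w))]
  have hv4 : 0 ≤ v ^ 4 := by positivity
  have huv : 0 ≤ u ^ 2 * v ^ 2 := by positivity
  rw [hw2, hw4] at cross
  rw [expand, hw2, hw4]
  nlinarith [mul_le_mul_of_nonneg_right hs_half huv, mul_nonneg hpq.le hv4]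

/-- `(2,4)`-hypercontractivity of the biased noise operator. -/
lemma expect_pow_four_le {p ρ : ℝ} (hp : p ∈ Set.Ioo (0 : ℝ) 1)
    (hρ : ρ ^ 2 = √(p * (1 - p)) / 2) {n : ℕ} (s : Finset (Fin n)) (c : Finset (Fin n) → ℝ) :
    expect p (fun x => (∑ S ∈ s.powerset, ρ ^ S.card * c S * walsh p S x) ^ 4) ≤
      (∑ S ∈ s.powerset, c S ^ 2) ^ 2 := by
  induction s using Finset.induction_on generalizing c with
  | empty => simp [walsh, expect_const, ← pow_mul]
  | insert i s hi ih =>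
    set u : (Fin n → Bool) → ℝ := fun x => ∑ S ∈ s.powerset, ρ ^ S.card * c S * walsh p S x
      with hu
    set v : (Fin n → Bool) → ℝ :=
      fun x => ∑ S ∈ s.powerset, ρ ^ S.card * c (insert i S) * walsh p S x with hv
    have notMem : ∀ S ∈ s.powerset, i ∉ S := fun S hS h => hi (Finset.mem_powerset.mp hS h)
    have split : ∀ x, ∑ S ∈ (insert i s).powerset, ρ ^ S.card * c S * walsh p S x =
        u x + ρ * bitChar p (x i) * v x := by
      intro x
      rw [Finset.sum_powerset_insert hi, hu, hv, Finset.mul_sum]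
      congr 1
      refine Finset.sum_congr rfl fun S hS => ?_
      rw [walsh_insert p (notMem S hS), Finset.card_insert_of_notMem (notMem S hS)]
      ring
    have hu_update : ∀ x b, u (Function.update x i b) = u x := fun x b =>
      Finset.sum_congr rfl fun S hS => by rw [walsh_update_of_notMem p (notMem S hS)]
    have hv_update : ∀ x b, v (Function.update x i b) = v x := fun x b =>
      Finset.sum_congr rfl fun S hS => by rw [walsh_update_of_notMem p (notMem S hS)]
    have hu4 := ih c
    have hv4 := ih fun S => c (insert i S)
    rw [Finset.sum_powerset_insert hi]
    set α := ∑ S ∈ s.powerset, c S ^ 2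
    set β := ∑ S ∈ s.powerset, c (insert i S) ^ 2
    have hα : 0 ≤ α := Finset.sum_nonneg fun _ _ => sq_nonneg _
    have hβ : 0 ≤ β := Finset.sum_nonneg fun _ _ => sq_nonneg _
    have huv : expect p (fun x => u x ^ 2 * v x ^ 2) ≤ α * β := by
      refine abs_le_of_sq_le_sq' ?_ (mul_nonneg hα hβ) |>.2
      calc expect p (fun x => u x ^ 2 * v x ^ 2) ^ 2
          ≤ expect p (fun x => (u x ^ 2) ^ 2) * expect p (fun x => (v x ^ 2) ^ 2) :=
            expect_mul_sq_le hp _ _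
        _ ≤ α ^ 2 * β ^ 2 := by
            simp only [← pow_mul]
            exact mul_le_mul hu4 hv4 (expect_nonneg hp fun x => Even.pow_nonneg (by decide) _)
              (sq_nonneg _)
        _ = (α * β) ^ 2 := by ring
    calc expect p (fun x => (∑ S ∈ (insert i s).powerset, ρ ^ S.card * c S * walsh p S x) ^ 4)
        = expect p (fun x => ∑ b, W p b * (u x + ρ * bitChar p b * v x) ^ 4) := by
          simp only [split]
          rw [← expect_average p i]
          simp only [hu_update, hv_update, Function.update_self]
      _ ≤ expect p (fun x => (u x ^ 2 + v x ^ 2) ^ 2) :=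
          expect_mono hp fun x => two_point_hypercontractive hp hρ _ _
      _ = expect p (fun x => u x ^ 4) + 2 * expect p (fun x => u x ^ 2 * v x ^ 2) +
            expect p (fun x => v x ^ 4) := by
          rw [← expect_const_mul, ← expect_add, ← expect_add]
          congr 1
          funext x
          ring
      _ ≤ (α + β) ^ 2 := by linarith

/-- Dual hypercontractivity, combined with interpolation between `L¹` and `L²`. -/
lemma sum_noise_coeff_sq_le {p : ℝ} (hp : p ∈ Set.Ioo (0 : ℝ) 1) {n : ℕ}
    (g : (Fin n → Bool) → ℝ) :
    ∑ S, (√(p * (1 - p)) / 2) ^ S.card * coeff p g S ^ 2 ≤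
      expect p (fun x => |g x|) * √(expect p fun x => g x ^ 2) := by
  set θ := √(p * (1 - p)) / 2
  have hθ : 0 ≤ θ := by positivity
  have hρ : √θ ^ 2 = θ := Real.sq_sqrt hθ
  set X := ∑ S, θ ^ S.card * coeff p g S ^ 2
  have hX0 : 0 ≤ X := Finset.sum_nonneg fun S _ => mul_nonneg (pow_nonneg hθ _) (sq_nonneg _)
  set h : (Fin n → Bool) → ℝ :=
    fun x => ∑ S, √θ ^ S.card * (√θ ^ S.card * coeff p g S) * walsh p S x with hh
  have h4 : expect p (fun x => h x ^ 4) ≤ X ^ 2 := by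
    have := expect_pow_four_le hp hρ Finset.univ fun S => √θ ^ S.card * coeff p g S
    simpa only [Finset.powerset_univ, mul_pow, ← pow_mul, mul_comm _ 2, pow_mul _ 2, hρ] using this
  have pairing : expect p (fun x => g x * h x) = X := by
    simp only [hh, Finset.mul_sum]
    rw [expect_sum]
    refine Finset.sum_congr rfl fun S _ => ?_
    have : ∀ x, g x * (√θ ^ S.card * (√θ ^ S.card * coeff p g S) * walsh p S x) =
        (θ ^ S.card * coeff p g S) * (g x * walsh p S x) := fun x => by
      rw [← hρ, Real.sqrt_sq (Real.sqrt_nonneg θ)]; ring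
    simp only [this]
    rw [expect_const_mul, ← coeff]
    ring
  set A := expect p (fun x => |g x|)
  set B := expect p (fun x => g x ^ 2)
  set D := expect p (fun x => |g x| * h x ^ 2)
  have hA0 : 0 ≤ A := expect_nonneg hp fun x => abs_nonneg _
  have hB0 : 0 ≤ B := expect_nonneg hp fun x => sq_nonneg _
  have first : X ^ 2 ≤ A * D := by
    have hsq : ∀ x, √|g x| ^ 2 = |g x| := fun x => Real.sq_sqrt (abs_nonneg _)
    have le : X ≤ expect p (fun x => √|g x| * (√|g x| * |h x|)) := by
      rw [← pairing]
      refine expect_mono hp fun x => ?_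
      rw [← mul_assoc, ← sq, hsq, ← abs_mul]
      exact le_abs_self _
    have := (pow_le_pow_left₀ hX0 le 2).trans (expect_mul_sq_le hp _ _)
    simpa only [mul_pow, hsq, sq_abs] using this
  have second : D ^ 2 ≤ B * X ^ 2 := by
    have := expect_mul_sq_le hp (fun x => |g x|) (fun x => h x ^ 2)
    simp only [sq_abs, ← pow_mul] at this
    exact this.trans (mul_le_mul_of_nonneg_left h4 hB0)
  rcases hX0.eq_or_lt with h0 | hpos
  · rw [← h0]
    exact mul_nonneg hA0 (Real.sqrt_nonneg _)
  have hX4 : X ^ 2 * X ^ 2 ≤ X ^ 2 * (A * √B) ^ 2 := by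
    calc X ^ 2 * X ^ 2 ≤ (A * D) * (A * D) :=
          mul_le_mul first first (sq_nonneg _) ((sq_nonneg _).trans first)
      _ = A ^ 2 * D ^ 2 := by ring
      _ ≤ A ^ 2 * (B * X ^ 2) := mul_le_mul_of_nonneg_left second (sq_nonneg _)
      _ = X ^ 2 * (A * √B) ^ 2 := by rw [mul_pow, Real.sq_sqrt hB0]; ring
  exact (abs_le_of_sq_le_sq' (le_of_mul_le_mul_left hX4 (by positivity))
    (mul_nonneg hA0 (Real.sqrt_nonneg _))).2

lemma var_eq_sum_coeff {p : ℝ} (hp : p ∈ Set.Ioo (0 : ℝ) 1) {n : ℕ} (f : (Fin n → Bool) → ℝ) :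
    var p f = ∑ i, ∑ S, coeff p (Δ p f i) S ^ 2 / S.card := by
  have hvar : var p f = expect p (fun x => f x ^ 2) - expect p f ^ 2 := by
    have : ∀ x, |f x - expect p f| ^ 2 =
        f x ^ 2 - (2 * expect p f * f x - expect p f ^ 2) := fun x => by rw [sq_abs]; ring
    change expect p (fun x => |f x - expect p f| ^ 2) = _
    simp only [this]
    rw [expect_sub, expect_sub, expect_const_mul, expect_const]
    ring
  rw [hvar, ← sum_coeff_sq hp, ← coeff_empty, Finset.sum_comm,
    ← Finset.add_sum_erase _ _ (Finset.mem_univ ∅), add_sub_cancel_left,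
    ← Finset.add_sum_erase _ (fun S => ∑ i, _) (Finset.mem_univ ∅)]
  simp only [Finset.card_empty, Nat.cast_zero, div_zero, Finset.sum_const_zero, zero_add]
  refine Finset.sum_congr rfl fun S hS => ?_
  have hcard : (S.card : ℝ) ≠ 0 := by
    simpa using Finset.ne_of_mem_erase hS
  simp only [coeff_Δ, ite_pow, ite_div, zero_pow two_ne_zero, zero_div]
  rw [Finset.sum_ite_mem, Finset.univ_inter, Finset.sum_const, nsmul_eq_mul]
  field_simp

lemma inv_le_of_one_le {a R : ℝ} (ha : 1 ≤ a) (hR : 1 ≤ R) {k : ℕ} (hk : 1 ≤ k) :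
    (k : ℝ)⁻¹ ≤ a / (1 + Real.log R) * (1 + Real.exp (-a) ^ k * R) := by
  have hk' : (1 : ℝ) ≤ k := by exact_mod_cast hk
  have hlog : 0 ≤ Real.log R := Real.log_nonneg hR
  have hu : 1 ≤ k * a := one_le_mul_of_one_le_of_one_le hk' ha
  have hexp : Real.exp (-a) ^ k * R = Real.exp (Real.log R - k * a) := by
    rw [← Real.exp_nat_mul, sub_eq_neg_add, Real.exp_add, Real.exp_log (by linarith), mul_neg]
  have key : 1 + Real.log R ≤ k * a * (1 + Real.exp (Real.log R - k * a)) := by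
    rcases le_total (1 + Real.log R) (k * a) with h | h
    · nlinarith [Real.exp_pos (Real.log R - k * a)]
    · nlinarith [Real.add_one_le_exp (Real.log R - k * a)]
  rw [hexp, inv_le_iff_one_le_mul₀ (by linarith), div_mul_eq_mul_div, div_mul_eq_mul_div,
    one_le_div (by linarith)]
  linarith

lemma sum_coeff_sq_div_card_le {p : ℝ} (hp : p ∈ Set.Ioo (0 : ℝ) 1) {n : ℕ}
    {g : (Fin n → Bool) → ℝ} (hg : g ≠ 0) (hg0 : coeff p g ∅ = 0) :
    ∑ S, coeff p g S ^ 2 / S.card ≤ 2 * Real.log (2 / (p * (1 - p))) *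
      (expect p (fun x => g x ^ 2) /
        Real.log (Real.exp 1 * √(expect p fun x => g x ^ 2) / expect p fun x => |g x|)) := by
  have noise := sum_noise_coeff_sq_le hp g
  have parseval := sum_coeff_sq hp g
  have hpq : 0 < p * (1 - p) := mul_pos hp.1 (by linarith [hp.2])
  have hpq4 : p * (1 - p) ≤ 1 / 4 := by nlinarith [sq_nonneg (2 * p - 1)]
  obtain ⟨x, hx⟩ := Function.ne_iff.mp hg
  set A := expect p (fun x => |g x|)
  set B := expect p (fun x => g x ^ 2)
  have hA : 0 < A := expect_pos hp (fun _ => abs_nonneg _) (abs_pos.mpr hx)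
  have hB : 0 < B := expect_pos hp (fun _ => sq_nonneg _) (sq_pos_of_ne_zero hx)
  have hAB : A ≤ √B := by
    refine Real.le_sqrt_of_sq_le ?_
    have := expect_mul_sq_le hp (fun x => |g x|) (fun _ => 1)
    simpa [expect_const] using this
  set θ := √(p * (1 - p)) / 2
  have hθ : 0 < θ := by positivity
  have hlogθ : -Real.log θ = Real.log (4 / (p * (1 - p))) / 2 := by
    have : 4 / (p * (1 - p)) = (θ ^ 2)⁻¹ := by
      rw [div_pow, Real.sq_sqrt hpq.le, inv_div]; norm_num
    rw [this, Real.log_inv, Real.log_pow]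
    push_cast; ring
  have one_le : 1 ≤ -Real.log θ := by
    rw [le_neg, Real.log_le_iff_le_exp hθ]
    have : √(p * (1 - p)) ≤ 1 / 2 := by
      rw [Real.sqrt_le_left (by norm_num)]; linarith
    have h3 := Real.exp_one_lt_three
    rw [Real.exp_neg]
    have h4 : (3 : ℝ)⁻¹ ≤ (Real.exp 1)⁻¹ := inv_anti₀ (Real.exp_pos 1) h3.le
    have : θ ≤ 1 / 4 := by simp only [θ]; linarith
    linarith
  have le_log : -Real.log θ ≤ Real.log (2 / (p * (1 - p))) := by
    have h : Real.log (4 / (p * (1 - p))) ≤ Real.log ((2 / (p * (1 - p))) ^ 2) := by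
      refine Real.log_le_log (by positivity) ?_
      rw [div_pow, div_le_div_iff₀ hpq (by positivity)]
      nlinarith
    rw [Real.log_pow] at h
    push_cast at h
    linarith
  have hR : 1 ≤ √B / A := (one_le_div hA).mpr hAB
  have hlogR : Real.log (Real.exp 1 * √B / A) = 1 + Real.log (√B / A) := by
    rw [mul_div_assoc, Real.log_mul (Real.exp_pos 1).ne' (by positivity), Real.log_exp]
  rw [hlogR]
  have hL : 0 < 1 + Real.log (√B / A) := by linarith [Real.log_nonneg hR]
  have bound : ∀ S, coeff p g S ^ 2 / S.card ≤ -Real.log θ / (1 + Real.log (√B / A)) *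
      (coeff p g S ^ 2 + √B / A * (θ ^ S.card * coeff p g S ^ 2)) := by
    intro S
    rcases S.eq_empty_or_nonempty with rfl | hS
    · simp [hg0]
    have := inv_le_of_one_le one_le hR (Finset.card_pos.mpr hS)
    rw [neg_neg, Real.exp_log hθ] at this
    have := mul_le_mul_of_nonneg_left this (sq_nonneg (coeff p g S))
    rw [div_eq_mul_inv]
    refine this.trans_eq ?_
    ring
  calc ∑ S, coeff p g S ^ 2 / S.card
      ≤ -Real.log θ / (1 + Real.log (√B / A)) *
          (B + √B / A * ∑ S, θ ^ S.card * coeff p g S ^ 2) := by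
        refine (Finset.sum_le_sum fun S _ => bound S).trans_eq ?_
        rw [← Finset.mul_sum, Finset.sum_add_distrib, parseval, Finset.mul_sum]
    _ ≤ -Real.log θ / (1 + Real.log (√B / A)) * (B + √B / A * (A * √B)) := by
        gcongr
    _ = 2 * -Real.log θ * (B / (1 + Real.log (√B / A))) := by
        have : √B / A * (A * √B) = B := by
          rw [div_mul_eq_mul_div, mul_left_comm, Real.mul_self_sqrt hB.le,
            mul_div_cancel_left₀ _ hA.ne']
        rw [this]; ring
    _ ≤ _ := by gcongr

lemma lpNorm_one (p : ℝ) {n : ℕ} (g : (Fin n → Bool) → ℝ) :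
    lpNorm p 1 g = expect p fun x => |g x| := by
  simp [lpNorm, expect]

lemma lpNorm_two (p : ℝ) {n : ℕ} (g : (Fin n → Bool) → ℝ) :
    lpNorm p 2 g = √(expect p fun x => g x ^ 2) := by
  simp [lpNorm, expect, Real.sqrt_eq_rpow]

/-- **Talagrand's variance bound** (Theorem 1.5 of Talagrand 1994). There is a universal
constant `K > 0` such that for every `p ∈ (0,1)`, every `n`, and every real-valued
function `f` on `({0,1}ⁿ, μ_p)`,
`Var(f) ≤ K log(2/(p(1-p))) ∑ᵢ ‖Δᵢf‖₂² / log(e ‖Δᵢf‖₂ / ‖Δᵢf‖₁)`,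
where a summand is interpreted as `0` when `Δᵢ f` is identically `0`. -/
theorem talagrand_variance_bound :
    ∃ K : ℝ, 0 < K ∧
      ∀ (p : ℝ), p ∈ Set.Ioo (0 : ℝ) 1 →
        ∀ (n : ℕ) (f : (Fin n → Bool) → ℝ),
          var p f ≤ K * Real.log (2 / (p * (1 - p))) *
            ∑ i : Fin n,
              if Δ p f i = 0 then 0
              else (lpNorm p 2 (Δ p f i)) ^ 2 /
                Real.log (Real.exp 1 * lpNorm p 2 (Δ p f i) / lpNorm p 1 (Δ p f i)) := by
  refine ⟨2, two_pos, fun p hp n f => ?_⟩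
  rw [var_eq_sum_coeff hp, Finset.mul_sum]
  refine Finset.sum_le_sum fun i _ => ?_
  split_ifs with hi
  · simp [hi, coeff, expect]
  · rw [lpNorm_one, lpNorm_two, Real.sq_sqrt (expect_nonneg hp fun x => sq_nonneg _)]
    exact sum_coeff_sq_div_card_le hp hi (by simp [coeff_Δ])

end Talagrand1994
end
end

section
/- (Counterexample to Theorem 3.3 of Hatami 2009.) Let Ω = [0,1] with Lebesgue measure μ, n = 2, and for an integer k ≥ 2 let f_k : [0,1]² → ℝ be the indicator function of [0,1/k]². Then I_{f_k}(1) = I_{f_k}(2) = 1/k, Var(f_k) = (1/k²)(1 − 1/k²), ‖Δ_i f_k‖₂² = (1 − 1/k)/k² for i = 1, 2, and for all sufficiently large k one has Var(f_k) > 10 · ∑_{i=1}^{2} ‖Δ_i f_k‖₂² / log(1/I_{f_k}(i)); hence the claimed inequality Var(f) ≤ 10 ∑_{i=1}^{n} ‖Δ_i f‖₂²/log(1/I_f(i)) is false in general. -/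
noncomputable section

open MeasureTheory
open scoped Classical

namespace HatamiCounterexample

/-- The uniform (Lebesgue) probability measure `μ` on `Ω = [0,1]`, modelled as Lebesgue
measure on `ℝ` restricted to `[0,1]`. -/
def μ0 : Measure ℝ := volume.restrict (Set.Icc (0 : ℝ) 1)

/-- The product measure `μ² = μ ⊗ μ` on `Ω² `. -/
def μ2 : Measure (Fin 2 → ℝ) := Measure.pi fun _ : Fin 2 => μ0

/-- `f_k`, the indicator function of `[0, 1/k]²`. -/
def fk (k : ℕ) (x : Fin 2 → ℝ) : ℝ :=
  if x 0 ∈ Set.Icc (0 : ℝ) (1 / k) ∧ x 1 ∈ Set.Icc (0 : ℝ) (1 / k) then 1 else 0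

/-- `I_{f_k}(i) = μ²({x : f_k is non-constant on s_i(x)})`, where
`s_i(x) = {y : y_j = x_j for all j ≠ i}`. -/
def Ifk (k : ℕ) (i : Fin 2) : ℝ :=
  (μ2 {x : Fin 2 → ℝ |
      ∃ ξ ξ' : ℝ, fk k (Function.update x i ξ) ≠ fk k (Function.update x i ξ')}).toReal

/-- The influence operator `Δᵢ f_k(x) = f_k(x) − ∫ f_k(…,ξ,…) dμ(ξ)`. -/
def Δfk (k : ℕ) (i : Fin 2) (x : Fin 2 → ℝ) : ℝ :=
  fk k x - ∫ ξ, fk k (Function.update x i ξ) ∂μ0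

/-- `Var(f_k) = ∫ |f_k − ∫ f_k dμ²|² dμ²`. -/
def varfk (k : ℕ) : ℝ :=
  ∫ x, (fk k x - ∫ x', fk k x' ∂μ2) ^ 2 ∂μ2

/-- `‖Δᵢ f_k‖₂²`. -/
def norm2sq (k : ℕ) (i : Fin 2) : ℝ := ∫ x, (Δfk k i x) ^ 2 ∂μ2

instance isProbabilityMeasure_μ0 : IsProbabilityMeasure μ0 :=
  ⟨by simp [μ0]⟩

instance isProbabilityMeasure_μ2 : IsProbabilityMeasure μ2 := by
  unfold μ2; infer_instance

lemma one_div_natCast_mem {k : ℕ} (hk : 2 ≤ k) : (1 / k : ℝ) ∈ Set.Icc (0 : ℝ) 1 := by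
  have : (1 : ℝ) ≤ k := by exact_mod_cast (by omega : 1 ≤ k)
  exact ⟨by positivity, (div_le_one (by positivity)).2 this⟩

lemma μ0_real_Icc {a : ℝ} (ha : a ∈ Set.Icc (0 : ℝ) 1) : μ0.real (Set.Icc 0 a) = a := by
  have h : Set.Icc (0 : ℝ) a ∩ Set.Icc 0 1 = Set.Icc 0 a :=
    Set.inter_eq_left.2 (Set.Icc_subset_Icc_right ha.2)
  rw [measureReal_def, μ0, Measure.restrict_apply measurableSet_Icc, h, Real.volume_Icc,
    sub_zero, ENNReal.toReal_ofReal ha.1]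

lemma μ2_real_pi (S : Fin 2 → Set ℝ) :
    μ2.real (Set.univ.pi S) = μ0.real (S 0) * μ0.real (S 1) := by
  simp [measureReal_def, μ2, Measure.pi_pi, Fin.prod_univ_two]

lemma μ2_real_coord (j : Fin 2) (A : Set ℝ) : μ2.real {x | x j ∈ A} = μ0.real A := by
  have h : {x : Fin 2 → ℝ | x j ∈ A} = Set.univ.pi (Function.update (fun _ => Set.univ) j A) := by
    ext x
    fin_cases j <;> simp [Set.mem_pi, Fin.forall_fin_two]
  rw [h, μ2_real_pi]
  fin_cases j <;> simp

/-- The indicator of the strip `{x | x j ∈ [0, 1/k]}`. -/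
def strip (k : ℕ) (j : Fin 2) (x : Fin 2 → ℝ) : ℝ :=
  if x j ∈ Set.Icc (0 : ℝ) (1 / k) then 1 else 0

lemma fk_eq_indicator (k : ℕ) :
    fk k = (Set.univ.pi fun _ : Fin 2 => Set.Icc (0 : ℝ) (1 / k)).indicator 1 := by
  ext x
  simp only [fk, Set.indicator, Set.mem_pi, Set.mem_univ, true_imp_iff, Fin.forall_fin_two,
    Pi.one_apply]

lemma strip_eq_indicator (k : ℕ) (j : Fin 2) :
    strip k j = {x : Fin 2 → ℝ | x j ∈ Set.Icc (0 : ℝ) (1 / k)}.indicator 1 := by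
  ext x
  simp only [strip, Set.indicator, Set.mem_ofPred_eq, Pi.one_apply]

lemma measurableSet_square (k : ℕ) :
    MeasurableSet (Set.univ.pi fun _ : Fin 2 => Set.Icc (0 : ℝ) (1 / k)) :=
  MeasurableSet.univ_pi fun _ => measurableSet_Icc

lemma measurableSet_strip (k : ℕ) (j : Fin 2) :
    MeasurableSet {x : Fin 2 → ℝ | x j ∈ Set.Icc (0 : ℝ) (1 / k)} :=
  measurable_pi_apply j measurableSet_Icc

lemma integrable_fk (k : ℕ) : Integrable (fk k) μ2 := by
  rw [fk_eq_indicator]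
  exact (integrable_const (1 : ℝ)).indicator (measurableSet_square k)

lemma integrable_strip (k : ℕ) (j : Fin 2) : Integrable (strip k j) μ2 := by
  rw [strip_eq_indicator]
  exact (integrable_const (1 : ℝ)).indicator (measurableSet_strip k j)

lemma integral_fk {k : ℕ} (hk : 2 ≤ k) : ∫ x, fk k x ∂μ2 = (1 / k : ℝ) ^ 2 := by
  rw [fk_eq_indicator, integral_indicator_one (measurableSet_square k), μ2_real_pi,
    μ0_real_Icc (one_div_natCast_mem hk), sq]

lemma integral_strip {k : ℕ} (hk : 2 ≤ k) (j : Fin 2) : ∫ x, strip k j x ∂μ2 = 1 / k := by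
  rw [strip_eq_indicator, integral_indicator_one (measurableSet_strip k j), μ2_real_coord,
    μ0_real_Icc (one_div_natCast_mem hk)]

lemma fk_update (k : ℕ) (i : Fin 2) (x : Fin 2 → ℝ) (ξ : ℝ) :
    fk k (Function.update x i ξ) =
      (Set.Icc (0 : ℝ) (1 / k)).indicator 1 ξ * strip k (1 - i) x := by
  simp only [fk, strip, Set.indicator, Pi.one_apply]
  fin_cases i <;> simp <;> split_ifs <;> simp_all

lemma integral_fk_update {k : ℕ} (hk : 2 ≤ k) (i : Fin 2) (x : Fin 2 → ℝ) :
    ∫ ξ, fk k (Function.update x i ξ) ∂μ0 = 1 / k * strip k (1 - i) x := by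
  simp_rw [fk_update]
  rw [integral_mul_const, integral_indicator_one measurableSet_Icc,
    μ0_real_Icc (one_div_natCast_mem hk)]

lemma fk_mul_strip (k : ℕ) (j : Fin 2) (x : Fin 2 → ℝ) : fk k x * strip k j x = fk k x := by
  unfold fk strip
  split_ifs with h hj
  · simp
  · fin_cases j
    exacts [absurd h.1 hj, absurd h.2 hj]
  all_goals simp

lemma fk_sq (k : ℕ) (x : Fin 2 → ℝ) : fk k x ^ 2 = fk k x := by
  unfold fk; split_ifs <;> simp

lemma strip_sq (k : ℕ) (j : Fin 2) (x : Fin 2 → ℝ) : strip k j x ^ 2 = strip k j x := by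
  unfold strip; split_ifs <;> simp

lemma Ifk_eq {k : ℕ} (hk : 2 ≤ k) (i : Fin 2) : Ifk k i = 1 / k := by
  have hk' := one_div_natCast_mem hk
  have h : {x : Fin 2 → ℝ |
      ∃ ξ ξ' : ℝ, fk k (Function.update x i ξ) ≠ fk k (Function.update x i ξ')} =
      {x | x (1 - i) ∈ Set.Icc (0 : ℝ) (1 / k)} := by
    ext x
    simp only [Set.mem_ofPred_eq, fk_update]
    constructor
    · rintro ⟨ξ, ξ', h⟩
      by_contra hx
      exact h (by simp only [strip, if_neg hx, mul_zero])
    · intro hx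
      refine ⟨0, 2, ?_⟩
      have h0 : (0 : ℝ) ∈ Set.Icc (0 : ℝ) (1 / k) := ⟨le_rfl, hk'.1⟩
      have h2 : (2 : ℝ) ∉ Set.Icc (0 : ℝ) (1 / k) := fun h => by linarith [h.2, hk'.2]
      simp only [strip, if_pos hx, Set.indicator_of_mem h0, Set.indicator_of_notMem h2]
      norm_num
  rw [Ifk, h, ← measureReal_def, μ2_real_coord, μ0_real_Icc hk']

lemma varfk_eq {k : ℕ} (hk : 2 ≤ k) :
    varfk k = 1 / (k : ℝ) ^ 2 * (1 - 1 / (k : ℝ) ^ 2) := by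
  have h (x : Fin 2 → ℝ) : (fk k x - (1 / k : ℝ) ^ 2) ^ 2 =
      (1 - 2 * (1 / k : ℝ) ^ 2) * fk k x + (1 / k : ℝ) ^ 4 := by
    linear_combination fk_sq k x
  simp_rw [varfk, integral_fk hk, h]
  rw [integral_add ((integrable_fk k).const_mul _) (integrable_const _), integral_const_mul,
    integral_fk hk, integral_const, probReal_univ, one_smul]
  ring

lemma norm2sq_eq {k : ℕ} (hk : 2 ≤ k) (i : Fin 2) :
    norm2sq k i = (1 - 1 / (k : ℝ)) / (k : ℝ) ^ 2 := by
  have h (x : Fin 2 → ℝ) : (fk k x - 1 / k * strip k (1 - i) x) ^ 2 =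
      (1 - 2 * (1 / k : ℝ)) * fk k x + (1 / k : ℝ) ^ 2 * strip k (1 - i) x := by
    linear_combination fk_sq k x - 2 * (1 / k : ℝ) * fk_mul_strip k (1 - i) x +
      (1 / k : ℝ) ^ 2 * strip_sq k (1 - i) x
  simp_rw [norm2sq, Δfk, integral_fk_update hk, h]
  rw [integral_add ((integrable_fk k).const_mul _) ((integrable_strip k _).const_mul _),
    integral_const_mul, integral_const_mul, integral_fk hk, integral_strip hk]
  ring

lemma varfk_gt {k : ℕ} (hk : 2 ≤ k) (hlog : 20 < Real.log k) :
    varfk k > 10 * ∑ i : Fin 2, norm2sq k i / Real.log (1 / Ifk k i) := by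
  have hk0 : (0 : ℝ) < k := by exact_mod_cast (by omega : 0 < k)
  have hk1 : (1 : ℝ) < k := by exact_mod_cast (by omega : 1 < k)
  simp only [varfk_eq hk, norm2sq_eq hk, Ifk_eq hk, one_div_one_div, Fin.sum_univ_two]
  have ha : 1 / (k : ℝ) < 1 := (div_lt_one hk0).2 hk1
  have hpos : 0 < (1 - 1 / (k : ℝ)) / (k : ℝ) ^ 2 := div_pos (by linarith) (by positivity)
  calc 10 * ((1 - 1 / (k : ℝ)) / (k : ℝ) ^ 2 / Real.log k +
        (1 - 1 / (k : ℝ)) / (k : ℝ) ^ 2 / Real.log k)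
      = (1 - 1 / (k : ℝ)) / (k : ℝ) ^ 2 * (20 / Real.log k) := by ring
    _ < (1 - 1 / (k : ℝ)) / (k : ℝ) ^ 2 * 1 :=
        mul_lt_mul_of_pos_left ((div_lt_one (by linarith)).2 hlog) hpos
    _ ≤ (1 - 1 / (k : ℝ)) / (k : ℝ) ^ 2 * (1 + 1 / k) :=
        mul_le_mul_of_nonneg_left (le_add_of_nonneg_right (by positivity)) hpos.le
    _ = 1 / (k : ℝ) ^ 2 * (1 - 1 / (k : ℝ) ^ 2) := by ring

end HatamiCounterexample

open HatamiCounterexample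

/-- **Counterexample to Theorem 3.3 of Hatami 2009.** For `Ω = [0,1]` with Lebesgue
measure, `n = 2`, and `f_k` the indicator of `[0,1/k]²` (`k ≥ 2`), one has
`I_{f_k}(1) = I_{f_k}(2) = 1/k`, `Var(f_k) = (1/k²)(1 − 1/k²)`,
`‖Δᵢ f_k‖₂² = (1 − 1/k)/k²` for `i = 1,2`, and for all sufficiently large `k`
`Var(f_k) > 10 ∑ᵢ ‖Δᵢ f_k‖₂² / log(1/I_{f_k}(i))`; hence the claimed inequality
`Var(f) ≤ 10 ∑ᵢ ‖Δᵢ f‖₂² / log(1/I_f(i))` is false in general. -/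
theorem hatami_claim_is_false :
    (∀ k : ℕ, 2 ≤ k →
      (∀ i : Fin 2, Ifk k i = 1 / k) ∧
      varfk k = 1 / (k : ℝ) ^ 2 * (1 - 1 / (k : ℝ) ^ 2) ∧
      (∀ i : Fin 2, norm2sq k i = (1 - 1 / (k : ℝ)) / (k : ℝ) ^ 2)) ∧
    (∃ k₀ : ℕ, ∀ k : ℕ, k₀ ≤ k →
      varfk k > 10 * ∑ i : Fin 2, norm2sq k i / Real.log (1 / Ifk k i)) := by
  refine ⟨fun k hk => ⟨Ifk_eq hk, varfk_eq hk, norm2sq_eq hk⟩, ?_⟩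
  obtain ⟨k₀, h⟩ := Filter.eventually_atTop.1
    ((Real.tendsto_log_atTop.comp tendsto_natCast_atTop_atTop).eventually_gt_atTop (20 : ℝ))
  exact ⟨max 2 k₀, fun k hk =>
    varfk_gt (le_of_max_le_left hk) (h k (le_of_max_le_right hk))⟩
end
end

section
/- (Corollary: generalized influence lower bound.) There is a universal constant C > 0 such that for each finite set Ω, each probability measure μ on Ω with p_min = min_{ω∈Ω} μ({ω}) > 0 and p_med > 0, each n ∈ ℕ, and each set A ⊆ Ωⁿ with 0 < max_{1≤i≤n} I_A(i), one has ∑_{i=1}^{n} I_A(i) ≥ C · [log(1/max_i I_A(i)) / (p_med · log(1/p_min))] · μⁿ(A)(1 − μⁿ(A)). -/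
noncomputable section

open scoped Classical

namespace GenTalagrand

variable {Ω : Type*} [Fintype Ω]

/-- The `n`-fold product measure `μⁿ` of the measure `μ` with weights `p`, as a weight
function on `Ωⁿ`. -/
def prodW (p : Ω → ℝ) {n : ℕ} (x : Fin n → Ω) : ℝ := ∏ i, p (x i)

/-- The measure `μⁿ(A)` of a set `A ⊆ Ωⁿ`. -/
def measOf (p : Ω → ℝ) {n : ℕ} (A : Set (Fin n → Ω)) : ℝ :=
  ∑ x ∈ Finset.univ.filter (· ∈ A), prodW p x

/-- The indicator function `𝟙_A` of a set `A ⊆ Ωⁿ`. -/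
def ind {n : ℕ} (A : Set (Fin n → Ω)) (x : Fin n → Ω) : ℝ := if x ∈ A then 1 else 0

/-- `I_A(i) = μⁿ({x ∈ Ωⁿ : 𝟙_A is non-constant on s_i(x)})`, where
`s_i(x) = {y : y_j = x_j for all j ≠ i}`. -/
def IA (p : Ω → ℝ) {n : ℕ} (A : Set (Fin n → Ω)) (i : Fin n) : ℝ :=
  ∑ x ∈ Finset.univ.filter
      (fun x : Fin n → Ω =>
        ∃ ξ ξ' : Ω, ind A (Function.update x i ξ) ≠ ind A (Function.update x i ξ')),
    prodW p x

/-- `p_med = max{μ(B) : B ⊆ Ω, μ(B) ≤ 1/2}`. -/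
def pmed (p : Ω → ℝ) : ℝ :=
  (Finset.univ.filter fun B : Finset Ω => ∑ ω ∈ B, p ω ≤ 1 / 2).sup'
    ⟨∅, by simp⟩ (fun B => ∑ ω ∈ B, p ω)

end GenTalagrand

open GenTalagrand

namespace GenTalagrand

section Scalar

/-- The tangent-line lower bound for `a * log (a / b)`. -/
lemma mul_log_tangent {a b k : ℝ} (ha : 0 ≤ a) (hb : 0 ≤ b) (hab : b = 0 → a = 0) (hk : 0 < k) :
    a * Real.log k + a - k * b ≤ a * Real.log a - a * Real.log b := by
  rcases ha.eq_or_lt with rfl | ha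
  · have := mul_nonneg hk.le hb
    simpa using this
  have hb : 0 < b := hb.lt_of_ne fun h => ha.ne' (hab h.symm)
  have h := Real.log_le_sub_one_of_pos (x := k * b / a) (by positivity)
  rw [Real.log_div (by positivity) ha.ne', Real.log_mul hk.ne' hb.ne'] at h
  have h2 := mul_le_mul_of_nonneg_left h ha.le
  have h3 : a * (k * b / a - 1) = k * b - a := by field_simp
  rw [h3] at h2
  linarith

lemma sq_mul_log_sq_le {r l : ℝ} (hr : 0 ≤ r) (hl : Real.log (r ^ 2) ≤ l) (hl0 : 0 ≤ l) :
    r ^ 2 * Real.log (r ^ 2) - r ^ 2 + 1 ≤ (3 + l) * (r - 1) ^ 2 := by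
  rcases hr.eq_or_lt with rfl | hr
  · simp; linarith
  have hlog := Real.log_le_sub_one_of_pos hr
  rw [Real.log_pow] at *
  push_cast at *
  rcases le_total r 1 with h1 | h1
  · have h2 : r ^ 2 * (2 * Real.log r) ≤ r ^ 2 * (2 * (r - 1)) := by gcongr
    have h3 : 0 ≤ (r - 1) ^ 2 * (2 * (1 - r)) := by
      have : 0 ≤ 1 - r := by linarith
      positivity
    have h4 : 0 ≤ l * (r - 1) ^ 2 := by positivity
    nlinarith
  · have h2 : (4 * r - 2) * Real.log r ≤ (4 * r - 2) * (r - 1) :=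
      mul_le_mul_of_nonneg_left hlog (by linarith)
    have h4 : 0 ≤ (l - 2 * Real.log r) * (r - 1) ^ 2 :=
      mul_nonneg (by linarith) (by positivity)
    nlinarith

/-- Pointwise form of the logarithmic Sobolev inequality around a nonzero mean `m`. -/
lemma sq_mul_log_sq_sub_le {h m R : ℝ} (hm : m ≠ 0) (hR : 1 ≤ R)
    (hh : (h - m) ^ 2 ≤ R * m ^ 2) :
    h ^ 2 * Real.log (h ^ 2) - h ^ 2 * Real.log (m ^ 2) - h ^ 2 + m ^ 2
      ≤ (5 + Real.log R) * (h - m) ^ 2 := by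
  have hm2 : 0 < m ^ 2 := by positivity
  have hlogR : 0 ≤ Real.log R := Real.log_nonneg hR
  set r := |h / m| with hrdef
  have hr2 : r ^ 2 = h ^ 2 / m ^ 2 := by rw [hrdef, sq_abs, div_pow]
  have hr4 : r ^ 2 ≤ 4 * R := by
    rw [hr2, div_le_iff₀ hm2]
    nlinarith [sq_nonneg (h - 2 * m)]
  have hl4 : Real.log 4 ≤ 2 := by
    have h2 := Real.log_two_lt_d9
    have : (4 : ℝ) = 2 ^ 2 := by norm_num
    rw [this, Real.log_pow]; push_cast; linarith
  have hl : Real.log (r ^ 2) ≤ 2 + Real.log R := by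
    rcases (sq_nonneg r).eq_or_lt with h0 | h0
    · rw [← h0]; simp; linarith
    · have := Real.log_le_log h0 hr4
      rw [Real.log_mul (by norm_num) (by positivity)] at this
      linarith
  have key := sq_mul_log_sq_le (abs_nonneg (h / m)) hl (by linarith)
  have hr1 : (r - 1) ^ 2 ≤ (h - m) ^ 2 / m ^ 2 := by
    have e : (h - m) ^ 2 / m ^ 2 = (h / m - 1) ^ 2 := by field_simp
    rw [e]
    have : |r - 1| ≤ |h / m - 1| := by simpa using abs_abs_sub_abs_le_abs_sub (h / m) 1
    exact sq_le_sq.mpr this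
  have key2 : r ^ 2 * Real.log (r ^ 2) - r ^ 2 + 1
      ≤ (5 + Real.log R) * ((h - m) ^ 2 / m ^ 2) := by
    refine key.trans ?_
    have : (3 + (2 + Real.log R)) = 5 + Real.log R := by ring
    rw [this]
    gcongr
  have key3 := mul_le_mul_of_nonneg_left key2 hm2.le
  have e2 : m ^ 2 * ((5 + Real.log R) * ((h - m) ^ 2 / m ^ 2))
      = (5 + Real.log R) * (h - m) ^ 2 := by field_simp
  rw [e2] at key3
  refine le_trans (le_of_eq ?_) key3
  rcases eq_or_ne h 0 with rfl | h0
  · rw [hr2]; simp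
  · rw [hr2, Real.log_div (by positivity) (by positivity)]
    field_simp

end Scalar

section SingleSpace

variable {Ω : Type*} [Fintype Ω]

lemma log_sum_le {p a b : Ω → ℝ} (hp : ∀ ω, 0 ≤ p ω) (ha : ∀ ω, 0 ≤ a ω) (hb : ∀ ω, 0 ≤ b ω)
    (hab : ∀ ω, b ω = 0 → a ω = 0) :
    (∑ ω, p ω * a ω) * Real.log (∑ ω, p ω * a ω) - (∑ ω, p ω * a ω) * Real.log (∑ ω, p ω * b ω)
      ≤ ∑ ω, p ω * (a ω * Real.log (a ω) - a ω * Real.log (b ω)) := by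
  have hpa : ∀ ω ∈ Finset.univ, 0 ≤ p ω * a ω := fun ω _ => mul_nonneg (hp ω) (ha ω)
  have hpb : ∀ ω ∈ Finset.univ, 0 ≤ p ω * b ω := fun ω _ => mul_nonneg (hp ω) (hb ω)
  set A := ∑ ω, p ω * a ω with hA
  set B := ∑ ω, p ω * b ω with hB
  rcases (Finset.sum_nonneg hpa).eq_or_lt with h0 | h0
  · have hz := (Finset.sum_eq_zero_iff_of_nonneg hpa).mp h0.symm
    have : ∑ ω, p ω * (a ω * Real.log (a ω) - a ω * Real.log (b ω)) = 0 := by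
      refine Finset.sum_eq_zero fun ω hω => ?_
      linear_combination (Real.log (a ω) - Real.log (b ω)) * hz ω hω
    rw [this, hA, ← h0]
    simp
  · have hB0 : 0 < B := by
      refine (Finset.sum_nonneg hpb).lt_of_ne fun h => h0.ne ?_
      have hz := (Finset.sum_eq_zero_iff_of_nonneg hpb).mp h.symm
      refine (Finset.sum_eq_zero fun ω hω => ?_).symm
      rcases mul_eq_zero.mp (hz ω hω) with h | h
      · simp [h]
      · simp [hab ω h]
    have hk : 0 < A / B := div_pos h0 hB0
    calc A * Real.log A - A * Real.log B
        = ∑ ω, p ω * (a ω * Real.log (A / B) + a ω - A / B * b ω) := by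
          have : ∀ ω, p ω * (a ω * Real.log (A / B) + a ω - A / B * b ω)
            = p ω * a ω * Real.log (A / B) + p ω * a ω - A / B * (p ω * b ω) := fun ω => by ring
          simp only [this, Finset.sum_add_distrib, Finset.sum_sub_distrib, ← Finset.sum_mul,
            ← Finset.mul_sum, ← hA, ← hB]
          rw [Real.log_div h0.ne' hB0.ne']
          field_simp
          ring
      _ ≤ _ := by
          exact Finset.sum_le_sum fun ω _ =>
            mul_le_mul_of_nonneg_left (mul_log_tangent (ha ω) (hb ω) (hab ω) hk) (hp ω)

/-- The logarithmic Sobolev inequality on a finite probability space, with the variance as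
Dirichlet form. -/
lemma logSobolev {p : Ω → ℝ} {R : ℝ} (hp : ∀ ω, 0 ≤ p ω) (hp1 : ∑ ω, p ω = 1) (hR : 1 ≤ R)
    (hpR : ∀ ω, 1 ≤ R * p ω) (h : Ω → ℝ) :
    ∑ ω, p ω * (h ω ^ 2 * Real.log (h ω ^ 2))
        - (∑ ω, p ω * h ω ^ 2) * Real.log (∑ ω, p ω * h ω ^ 2)
      ≤ (2 * Real.log R + 5) * ∑ ω, p ω * (h ω - ∑ ω', p ω' * h ω') ^ 2 := by
  have hlogR : 0 ≤ Real.log R := Real.log_nonneg hR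
  set m := ∑ ω, p ω * h ω with hm
  set v := ∑ ω, p ω * (h ω - m) ^ 2 with hv
  set T := ∑ ω, p ω * h ω ^ 2 with hT
  have hv0 : 0 ≤ v := Finset.sum_nonneg fun ω _ => mul_nonneg (hp ω) (sq_nonneg _)
  have hT0 : 0 ≤ T := Finset.sum_nonneg fun ω _ => mul_nonneg (hp ω) (sq_nonneg _)
  have hTv : T = v + m ^ 2 := by
    have : ∀ ω, p ω * (h ω - m) ^ 2 = p ω * h ω ^ 2 - 2 * m * (p ω * h ω) + m ^ 2 * p ω :=
      fun ω => by ring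
    rw [hv]
    simp only [this, Finset.sum_add_distrib, Finset.sum_sub_distrib, ← Finset.mul_sum, hp1,
      ← hm, ← hT]
    ring
  have hsup : ∀ g : Ω → ℝ, ∀ ω, g ω ^ 2 ≤ R * ∑ ω', p ω' * g ω' ^ 2 := by
    intro g ω
    have h1 : p ω * g ω ^ 2 ≤ ∑ ω', p ω' * g ω' ^ 2 :=
      Finset.single_le_sum (f := fun ω' => p ω' * g ω' ^ 2)
        (fun ω' _ => mul_nonneg (hp ω') (sq_nonneg _)) (Finset.mem_univ ω)
    have h2 := mul_le_mul_of_nonneg_left h1 (zero_le_one.trans hR)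
    nlinarith [mul_le_mul_of_nonneg_right (hpR ω) (sq_nonneg (g ω))]
  rcases le_or_gt (m ^ 2) v with hcase | hcase
  · have h1 : ∑ ω, p ω * (h ω ^ 2 * Real.log (h ω ^ 2))
        ≤ ∑ ω, p ω * (h ω ^ 2 * (Real.log R + Real.log T)) := by
      refine Finset.sum_le_sum fun ω _ => mul_le_mul_of_nonneg_left ?_ (hp ω)
      rcases eq_or_ne (h ω) 0 with h0 | h0
      · simp [h0]
      have hs := hsup h ω
      have hpos : 0 < h ω ^ 2 := by positivity
      have hTpos : 0 < T := hT0.lt_of_ne fun h' => by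
        rw [← hT, ← h'] at hs; linarith
      refine mul_le_mul_of_nonneg_left ?_ hpos.le
      rw [← Real.log_mul (by positivity) hTpos.ne']
      exact Real.log_le_log hpos hs
    have h2 : ∑ ω, p ω * (h ω ^ 2 * (Real.log R + Real.log T))
        = T * (Real.log R + Real.log T) := by
      rw [hT, Finset.sum_mul]
      exact Finset.sum_congr rfl fun ω _ => by ring
    have h3 : T * Real.log R ≤ 2 * v * Real.log R := by
      gcongr
      linarith
    nlinarith
  · have hm0 : m ≠ 0 := by
      rintro h0
      rw [h0] at hcase
      simp at hcase
      linarith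
    have hm2 : 0 < m ^ 2 := by positivity
    have h1 : ∑ ω, p ω * (h ω ^ 2 * Real.log (h ω ^ 2) - h ω ^ 2 * Real.log (m ^ 2)
          - h ω ^ 2 + m ^ 2) ≤ ∑ ω, p ω * ((5 + Real.log R) * (h ω - m) ^ 2) := by
      refine Finset.sum_le_sum fun ω _ => mul_le_mul_of_nonneg_left ?_ (hp ω)
      refine sq_mul_log_sq_sub_le hm0 hR ?_
      exact (hsup (fun ω => h ω - m) ω).trans
        (mul_le_mul_of_nonneg_left hcase.le (by linarith))
    have e1 : ∑ ω, p ω * (h ω ^ 2 * Real.log (h ω ^ 2) - h ω ^ 2 * Real.log (m ^ 2)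
          - h ω ^ 2 + m ^ 2) = ∑ ω, p ω * (h ω ^ 2 * Real.log (h ω ^ 2))
            - T * Real.log (m ^ 2) - T + m ^ 2 := by
      have : ∀ ω, p ω * (h ω ^ 2 * Real.log (h ω ^ 2) - h ω ^ 2 * Real.log (m ^ 2)
          - h ω ^ 2 + m ^ 2) = p ω * (h ω ^ 2 * Real.log (h ω ^ 2))
            - p ω * h ω ^ 2 * Real.log (m ^ 2) - p ω * h ω ^ 2 + p ω * m ^ 2 := fun ω => by ring
      simp only [this, Finset.sum_add_distrib, Finset.sum_sub_distrib, ← Finset.sum_mul, hp1,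
        ← hT, one_mul]
    have e2 : ∑ ω, p ω * ((5 + Real.log R) * (h ω - m) ^ 2) = (5 + Real.log R) * v := by
      rw [hv, Finset.mul_sum]
      exact Finset.sum_congr rfl fun ω _ => by ring
    have h2 := mul_log_tangent hT0 hm2.le (fun h => absurd h hm2.ne') one_pos
    rw [Real.log_one] at h2
    nlinarith [mul_nonneg hlogR hv0]

end SingleSpace

section Weights

variable {Ω : Type*} {n : ℕ} {p : Ω → ℝ}

lemma prodW_nonneg (hp : ∀ ω, 0 ≤ p ω) (x : Fin n → Ω) : 0 ≤ prodW p x :=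
  Finset.prod_nonneg fun i _ => hp (x i)

lemma prodW_update (x : Fin n → Ω) (i : Fin n) (ω : Ω) :
    prodW p (Function.update x i ω) * p (x i) = prodW p x * p ω := by
  simp only [prodW]
  rw [← Finset.mul_prod_erase _ _ (Finset.mem_univ i),
    ← Finset.mul_prod_erase _ (fun j => p (x j)) (Finset.mem_univ i)]
  have : ∏ j ∈ Finset.univ.erase i, p (Function.update x i ω j)
      = ∏ j ∈ Finset.univ.erase i, p (x j) :=
    Finset.prod_congr rfl fun j hj => by
      rw [Function.update_of_ne (Finset.ne_of_mem_erase hj)]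
  rw [this, Function.update_self]
  ring

lemma ind_sq (A : Set (Fin n → Ω)) (x : Fin n → Ω) : ind A x ^ 2 = ind A x := by
  unfold ind
  split_ifs <;> norm_num

end Weights

section Product

variable {Ω : Type*} [Fintype Ω] {n : ℕ} {p : Ω → ℝ}

/-- The expectation with respect to the product measure. -/
def expect (p : Ω → ℝ) (f : (Fin n → Ω) → ℝ) : ℝ := ∑ x, prodW p x * f x

/-- Averaging over the `i`-th coordinate. -/
def avg (p : Ω → ℝ) (i : Fin n) (f : (Fin n → Ω) → ℝ) : (Fin n → Ω) → ℝ :=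
  fun x => ∑ ω, p ω * f (Function.update x i ω)

/-- Averaging successively over the coordinates in a list. -/
def avgList (p : Ω → ℝ) (l : List (Fin n)) (f : (Fin n → Ω) → ℝ) : (Fin n → Ω) → ℝ :=
  l.foldr (avg p) f

/-- The deviation of `f` from its average over the `i`-th coordinate. -/
def dev (p : Ω → ℝ) (i : Fin n) (f : (Fin n → Ω) → ℝ) : (Fin n → Ω) → ℝ :=
  fun x => f x - avg p i f x

lemma expect_mono (hp : ∀ ω, 0 ≤ p ω) {f g : (Fin n → Ω) → ℝ} (h : ∀ x, f x ≤ g x) :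
    expect p f ≤ expect p g :=
  Finset.sum_le_sum fun x _ => mul_le_mul_of_nonneg_left (h x) (prodW_nonneg hp x)

lemma expect_add (f g : (Fin n → Ω) → ℝ) :
    expect p (fun x => f x + g x) = expect p f + expect p g := by
  simp only [expect, mul_add, Finset.sum_add_distrib]

lemma expect_sub (f g : (Fin n → Ω) → ℝ) :
    expect p (fun x => f x - g x) = expect p f - expect p g := by
  simp only [expect, mul_sub, Finset.sum_sub_distrib]

lemma expect_const_mul (c : ℝ) (f : (Fin n → Ω) → ℝ) :
    expect p (fun x => c * f x) = c * expect p f := by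
  simp only [expect, Finset.mul_sum]
  exact Finset.sum_congr rfl fun x _ => by ring

lemma expect_const (hp1 : ∑ ω, p ω = 1) (c : ℝ) :
    expect p (fun _ : Fin n → Ω => c) = c := by
  have h : ∑ x : Fin n → Ω, prodW p x = 1 := by
    have := Finset.prod_univ_sum (fun _ : Fin n => (Finset.univ : Finset Ω)) (fun _ ω => p ω)
    simp only [hp1, Finset.prod_const_one, Fintype.piFinset_univ] at this
    exact this.symm
  simp only [expect, ← Finset.sum_mul, h, one_mul]

lemma expect_avg (hp1 : ∑ ω, p ω = 1) (i : Fin n) (f : (Fin n → Ω) → ℝ) :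
    expect p (avg p i f) = expect p f := by
  have h1 : expect p (avg p i f)
      = ∑ z : (Fin n → Ω) × Ω, prodW p z.1 * p z.2 * f (Function.update z.1 i z.2) := by
    simp only [expect, avg, Finset.mul_sum, Fintype.sum_prod_type, mul_assoc]
  have h2 : expect p f = ∑ z : (Fin n → Ω) × Ω, prodW p z.1 * p z.2 * f z.1 := by
    simp only [Fintype.sum_prod_type, expect]
    refine Finset.sum_congr rfl fun x _ => ?_
    rw [← Finset.sum_mul, ← Finset.mul_sum, hp1, mul_one]
  rw [h1, h2]
  have hinv : Function.Involutive
      (fun z : (Fin n → Ω) × Ω => (Function.update z.1 i z.2, z.1 i)) := by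
    rintro ⟨x, ω⟩
    simp
  refine Fintype.sum_equiv hinv.toPerm _ _ ?_
  rintro ⟨x, ω⟩
  simp [prodW_update]

lemma avg_mono (hp : ∀ ω, 0 ≤ p ω) (i : Fin n) {f g : (Fin n → Ω) → ℝ} (h : ∀ x, f x ≤ g x)
    (x : Fin n → Ω) : avg p i f x ≤ avg p i g x :=
  Finset.sum_le_sum fun ω _ => mul_le_mul_of_nonneg_left (h _) (hp ω)

lemma avg_nonneg (hp : ∀ ω, 0 ≤ p ω) (i : Fin n) {f : (Fin n → Ω) → ℝ} (h : ∀ x, 0 ≤ f x)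
    (x : Fin n → Ω) : 0 ≤ avg p i f x :=
  Finset.sum_nonneg fun ω _ => mul_nonneg (hp ω) (h _)

lemma avg_sub (i : Fin n) (f g : (Fin n → Ω) → ℝ) :
    avg p i (fun x => f x - g x) = fun x => avg p i f x - avg p i g x := by
  funext x
  simp only [avg, mul_sub, Finset.sum_sub_distrib]

lemma avg_update (i : Fin n) (f : (Fin n → Ω) → ℝ) (x : Fin n → Ω) (ω : Ω) :
    avg p i f (Function.update x i ω) = avg p i f x := by
  simp only [avg, Function.update_idem]

lemma avg_mul_avg (i : Fin n) (f : (Fin n → Ω) → ℝ) {g : (Fin n → Ω) → ℝ}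
    (hg : ∀ x ω, g (Function.update x i ω) = g x) (x : Fin n → Ω) :
    avg p i (fun y => f y * g y) x = avg p i f x * g x := by
  simp only [avg, hg, Finset.sum_mul, mul_assoc]

lemma expect_mul_invariant (hp1 : ∑ ω, p ω = 1) (i : Fin n) (f : (Fin n → Ω) → ℝ)
    {g : (Fin n → Ω) → ℝ} (hg : ∀ x ω, g (Function.update x i ω) = g x) :
    expect p (fun x => f x * g x) = expect p (fun x => avg p i f x * g x) := by
  rw [← expect_avg hp1 i]
  exact congrArg _ (funext fun x => avg_mul_avg i f hg x)

lemma avg_comm (i j : Fin n) (f : (Fin n → Ω) → ℝ) :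
    avg p i (avg p j f) = avg p j (avg p i f) := by
  rcases eq_or_ne i j with rfl | hij
  · rfl
  funext x
  simp only [avg, Finset.mul_sum]
  rw [Finset.sum_comm]
  refine Finset.sum_congr rfl fun a _ => Finset.sum_congr rfl fun b _ => ?_
  rw [Function.update_comm hij]
  ring

lemma avgList_cons (i : Fin n) (l : List (Fin n)) (f : (Fin n → Ω) → ℝ) :
    avgList p (i :: l) f = avg p i (avgList p l f) := rfl

lemma avgList_sub (l : List (Fin n)) (f g : (Fin n → Ω) → ℝ) :
    avgList p l (fun x => f x - g x) = fun x => avgList p l f x - avgList p l g x := by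
  induction l with
  | nil => rfl
  | cons i l ih => simp only [avgList_cons, ih, avg_sub]

lemma avgList_avg (l : List (Fin n)) (i : Fin n) (f : (Fin n → Ω) → ℝ) :
    avgList p l (avg p i f) = avg p i (avgList p l f) := by
  induction l with
  | nil => rfl
  | cons j l ih => rw [avgList_cons, ih, avg_comm, avgList_cons]

lemma avgList_dev (l : List (Fin n)) (i : Fin n) (f : (Fin n → Ω) → ℝ) :
    avgList p l (dev p i f) = dev p i (avgList p l f) := by
  unfold dev
  rw [avgList_sub, avgList_avg]

lemma dev_comm (i j : Fin n) (f : (Fin n → Ω) → ℝ) :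
    dev p i (dev p j f) = dev p j (dev p i f) := by
  unfold dev
  funext x
  simp only [avg_sub, avg_comm i j f]
  ring

lemma expect_avgList (hp1 : ∑ ω, p ω = 1) (l : List (Fin n)) (f : (Fin n → Ω) → ℝ) :
    expect p (avgList p l f) = expect p f := by
  induction l with
  | nil => rfl
  | cons i l ih => rw [avgList_cons, expect_avg hp1, ih]

lemma avgList_nonneg (hp : ∀ ω, 0 ≤ p ω) (l : List (Fin n)) {f : (Fin n → Ω) → ℝ}
    (h : ∀ x, 0 ≤ f x) : ∀ x, 0 ≤ avgList p l f x := by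
  induction l with
  | nil => exact h
  | cons i l ih => exact avg_nonneg hp i ih

lemma abs_avgList_le (hp : ∀ ω, 0 ≤ p ω) (l : List (Fin n)) (f : (Fin n → Ω) → ℝ) :
    ∀ x, |avgList p l f x| ≤ avgList p l (fun y => |f y|) x := by
  induction l with
  | nil => exact fun x => le_rfl
  | cons i l ih =>
    intro x
    refine (Finset.abs_sum_le_sum_abs _ _).trans (Finset.sum_le_sum fun ω _ => ?_)
    rw [abs_mul, abs_of_nonneg (hp ω)]
    exact mul_le_mul_of_nonneg_left (ih _) (hp ω)

lemma avgList_congr (l : List (Fin n)) (f : (Fin n → Ω) → ℝ) :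
    ∀ x y : Fin n → Ω, (∀ i ∉ l, x i = y i) → avgList p l f x = avgList p l f y := by
  induction l with
  | nil => exact fun x y h => congrArg f (funext fun i => h i (by simp))
  | cons i l ih =>
    intro x y h
    refine Finset.sum_congr rfl fun ω _ => congrArg _ (ih _ _ fun j hj => ?_)
    rcases eq_or_ne j i with rfl | hji
    · simp
    · rw [Function.update_of_ne hji, Function.update_of_ne hji]
      exact h j (by simp [hji, hj])

lemma avgList_eq_expect (hp1 : ∑ ω, p ω = 1) {l : List (Fin n)} (hl : ∀ i, i ∈ l)
    (f : (Fin n → Ω) → ℝ) : avgList p l f = fun _ => expect p f := by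
  funext x
  have h : avgList p l f = fun _ => avgList p l f x :=
    funext fun y => avgList_congr l f y x fun i hi => absurd (hl i) hi
  rw [← expect_avgList hp1 l f, h, expect_const hp1]

lemma expect_sq_dev (hp1 : ∑ ω, p ω = 1) (i : Fin n) (f : (Fin n → Ω) → ℝ) :
    expect p (fun x => dev p i f x ^ 2)
      = expect p (fun x => f x ^ 2) - expect p (fun x => avg p i f x ^ 2) := by
  have h := expect_mul_invariant hp1 i f (avg_update (p := p) i f)
  have e : (fun x => dev p i f x ^ 2)
      = fun x => (f x ^ 2 - 2 * (f x * avg p i f x)) + avg p i f x * avg p i f x := by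
    funext x
    simp only [dev]
    ring
  rw [e, expect_add, expect_sub, expect_const_mul, h]
  simp only [pow_two]
  ring

/-- Averaging in one coordinate does not increase the mean entropy in another coordinate. -/
lemma entropy_avg_le (hp : ∀ ω, 0 < p ω) (hp1 : ∑ ω, p ω = 1) (i j : Fin n)
    {F : (Fin n → Ω) → ℝ} (hF : ∀ x, 0 ≤ F x) :
    expect p (fun x => avg p j F x * Real.log (avg p j F x))
        - expect p (fun x => avg p i (avg p j F) x * Real.log (avg p i (avg p j F) x))
      ≤ expect p (fun x => F x * Real.log (F x))
        - expect p (fun x => avg p i F x * Real.log (avg p i F x)) := by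
  have hinv : ∀ G : (Fin n → Ω) → ℝ,
      expect p (fun x => avg p i G x * Real.log (avg p i G x))
        = expect p (fun x => G x * Real.log (avg p i G x)) := fun G =>
    (expect_mul_invariant hp1 i G fun x ω => by rw [avg_update]).symm
  rw [hinv, hinv, ← expect_sub, ← expect_sub,
    ← expect_avg hp1 j (fun x => F x * Real.log (F x) - F x * Real.log (avg p i F x))]
  refine expect_mono (fun ω => (hp ω).le) fun x => ?_
  rw [avg_comm i j F]
  refine log_sum_le (fun ω => (hp ω).le) (fun ω => hF _)
    (fun ω => avg_nonneg (fun ω => (hp ω).le) i hF _) fun ω h => ?_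
  have hz := (Finset.sum_eq_zero_iff_of_nonneg
    fun ω' _ => mul_nonneg (hp ω').le (hF _)).mp h
  set y := Function.update x j ω
  have := hz (y i) (Finset.mem_univ _)
  rw [Function.update_eq_self] at this
  exact (mul_eq_zero.mp this).resolve_left (hp _).ne'

lemma entropy_avgList_le (hp : ∀ ω, 0 < p ω) (hp1 : ∑ ω, p ω = 1) (i : Fin n)
    (l : List (Fin n)) {F : (Fin n → Ω) → ℝ} (hF : ∀ x, 0 ≤ F x) :
    expect p (fun x => avgList p l F x * Real.log (avgList p l F x))
        - expect p (fun x => avg p i (avgList p l F) x * Real.log (avg p i (avgList p l F) x))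
      ≤ expect p (fun x => F x * Real.log (F x))
        - expect p (fun x => avg p i F x * Real.log (avg p i F x)) := by
  induction l with
  | nil => exact le_rfl
  | cons j l ih =>
    exact (entropy_avg_le hp hp1 i j (avgList_nonneg (fun ω => (hp ω).le) l hF)).trans ih

/-- Subadditivity of entropy along a list of coordinates. -/
lemma entropy_subadditive (hp : ∀ ω, 0 < p ω) (hp1 : ∑ ω, p ω = 1)
    (l : List (Fin n)) {F : (Fin n → Ω) → ℝ} (hF : ∀ x, 0 ≤ F x) :
    expect p (fun x => F x * Real.log (F x))
        - expect p (fun x => avgList p l F x * Real.log (avgList p l F x))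
      ≤ (l.map fun i => expect p (fun x => F x * Real.log (F x))
        - expect p (fun x => avg p i F x * Real.log (avg p i F x))).sum := by
  induction l with
  | nil => simp [avgList]
  | cons i l ih =>
    have := entropy_avgList_le hp hp1 i l hF
    rw [List.map_cons, List.sum_cons, avgList_cons]
    linarith

/-- The logarithmic Sobolev inequality on the product space. -/
lemma logSobolev_prod {R : ℝ} (hp : ∀ ω, 0 < p ω) (hp1 : ∑ ω, p ω = 1) (hR : 1 ≤ R)
    (hpR : ∀ ω, 1 ≤ R * p ω) (g : (Fin n → Ω) → ℝ) :
    expect p (fun x => g x ^ 2 * Real.log (g x ^ 2))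
        - expect p (fun x => g x ^ 2) * Real.log (expect p (fun x => g x ^ 2))
      ≤ (2 * Real.log R + 5) * ∑ j, expect p (fun x => dev p j g x ^ 2) := by
  have h := entropy_subadditive hp hp1 (List.finRange n) (F := fun x => g x ^ 2)
    fun x => sq_nonneg _
  rw [avgList_eq_expect hp1 List.mem_finRange, expect_const hp1] at h
  refine h.trans ?_
  rw [← List.ofFn_eq_map, List.sum_ofFn, Finset.mul_sum]
  refine Finset.sum_le_sum fun j _ => ?_
  rw [← expect_avg hp1 j (fun x => g x ^ 2 * Real.log (g x ^ 2)),
    ← expect_avg hp1 j (fun x => dev p j g x ^ 2), ← expect_sub, ← expect_const_mul]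
  refine expect_mono (fun ω => (hp ω).le) fun x => ?_
  have := logSobolev (fun ω => (hp ω).le) hp1 hR hpR fun ω => g (Function.update x j ω)
  simpa only [avg, dev, Function.update_idem] using this

/-- A lower bound on the entropy of `g ^ 2` when `g` has a small first moment. -/
lemma le_entropy_sq (hp : ∀ ω, 0 < p ω) {M a : ℝ} (hM : 0 < M) {g : (Fin n → Ω) → ℝ}
    (ha : expect p (fun x => |g x|) ≤ a) :
    expect p (fun x => g x ^ 2) * Real.log (1 / M)
      ≤ expect p (fun x => g x ^ 2 * Real.log (g x ^ 2))
        - expect p (fun x => g x ^ 2) * Real.log (expect p (fun x => g x ^ 2)) + a ^ 2 / M := by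
  set w := expect p (fun x => g x ^ 2) with hw
  have hp' : ∀ ω, 0 ≤ p ω := fun ω => (hp ω).le
  have hnn : ∀ x ∈ Finset.univ, 0 ≤ prodW p x * g x ^ 2 := fun x _ =>
    mul_nonneg (prodW_nonneg hp' x) (sq_nonneg _)
  have haM : 0 ≤ a ^ 2 / M := by positivity
  rcases (Finset.sum_nonneg hnn).eq_or_lt with h0 | h0
  · have hw0 : w = 0 := h0.symm
    have hz := (Finset.sum_eq_zero_iff_of_nonneg hnn).mp h0.symm
    have : expect p (fun x => g x ^ 2 * Real.log (g x ^ 2)) = 0 :=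
      Finset.sum_eq_zero fun x hx => by rw [← mul_assoc, hz x hx, zero_mul]
    rw [this, hw0]
    simpa using haM
  have hw0 : 0 < w := h0
  set k := √(w / M) with hk
  have hk0 : 0 < k := Real.sqrt_pos.mpr (div_pos hw0 hM)
  have hk2 : k ^ 2 = w / M := Real.sq_sqrt (div_pos hw0 hM).le
  have hlogk : 2 * Real.log k = Real.log w + Real.log (1 / M) := by
    have : Real.log (k ^ 2) = 2 * Real.log k := by rw [Real.log_pow]; norm_num
    rw [← this, hk2, Real.log_div hw0.ne' hM.ne', one_div, Real.log_inv]
    ring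
  have hpt : ∀ x, (2 * Real.log k + 2) * g x ^ 2 - 2 * k * |g x|
      ≤ g x ^ 2 * Real.log (g x ^ 2) := by
    intro x
    have h := mul_log_tangent (abs_nonneg (g x)) zero_le_one (by norm_num) hk0
    have h2 := mul_le_mul_of_nonneg_left h (abs_nonneg (g x))
    have h3 : Real.log (g x ^ 2) = 2 * Real.log |g x| := by
      rw [Real.log_pow, Real.log_abs]; norm_num
    rw [Real.log_one] at h2
    rw [h3, ← sq_abs (g x)]
    nlinarith
  have hE := expect_mono hp' hpt
  rw [expect_sub, expect_const_mul, expect_const_mul, ← hw, hlogk] at hE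
  have hka : k * expect p (fun x => |g x|) ≤ k * a := mul_le_mul_of_nonneg_left ha hk0.le
  have hsq : 2 * (k * a) ≤ w + a ^ 2 / M := by
    have h1 : 0 ≤ (k * M - a) ^ 2 / M := by positivity
    have h2 : (k * M - a) ^ 2 / M = k ^ 2 * M - 2 * (k * a) + a ^ 2 / M := by
      field_simp
      ring
    rw [h2, hk2, div_mul_cancel₀ _ hM.ne'] at h1
    linarith
  linarith

/-- The martingale-difference step of the Falik–Samorodnitsky argument, summed along a list of
coordinates. -/
lemma variance_avgList_le {R : ℝ} (hp : ∀ ω, 0 < p ω) (hp1 : ∑ ω, p ω = 1) (hR : 1 ≤ R)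
    (hpR : ∀ ω, 1 ≤ R * p ω) {M : ℝ} (hM : 0 < M) (f : (Fin n → Ω) → ℝ) (l : List (Fin n)) :
    (expect p (fun x => f x ^ 2) - expect p (fun x => avgList p l f x ^ 2)) * Real.log (1 / M)
      ≤ (2 * Real.log R + 5) * ∑ j, (expect p (fun x => dev p j f x ^ 2)
          - expect p (fun x => avgList p l (dev p j f) x ^ 2))
        + (l.map fun i => expect p (fun x => |dev p i f x|) ^ 2 / M).sum := by
  induction l with
  | nil => simp [avgList]
  | cons i l ih =>
    set g := dev p i (avgList p l f) with hg
    have ha : expect p (fun x => |g x|) ≤ expect p (fun x => |dev p i f x|) := by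
      rw [hg, ← avgList_dev, ← expect_avgList hp1 l (fun x => |dev p i f x|)]
      exact expect_mono (fun ω => (hp ω).le) (abs_avgList_le (fun ω => (hp ω).le) l _)
    have h1 := le_entropy_sq hp hM ha
    have h2 := logSobolev_prod hp hp1 hR hpR g
    have h3 : ∀ j, expect p (fun x => dev p j g x ^ 2)
        = expect p (fun x => avgList p l (dev p j f) x ^ 2)
          - expect p (fun x => avgList p (i :: l) (dev p j f) x ^ 2) := by
      intro j
      rw [hg, dev_comm, ← avgList_dev, expect_sq_dev hp1, avgList_cons]
    have h4 := expect_sq_dev hp1 i (avgList p l f)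
    rw [← hg] at h4
    simp only [h3, Finset.sum_sub_distrib] at h2
    rw [h4] at h1 h2
    simp only [Finset.sum_sub_distrib] at ih ⊢
    rw [List.map_cons, List.sum_cons]
    simp only [avgList_cons] at h2 ⊢
    linarith

/-- The variance bound obtained from the logarithmic Sobolev inequality. -/
lemma variance_mul_log_le {R : ℝ} (hp : ∀ ω, 0 < p ω) (hp1 : ∑ ω, p ω = 1) (hR : 1 ≤ R)
    (hpR : ∀ ω, 1 ≤ R * p ω) {M : ℝ} (hM : 0 < M) (f : (Fin n → Ω) → ℝ) :
    (expect p (fun x => f x ^ 2) - expect p f ^ 2) * Real.log (1 / M)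
      ≤ (2 * Real.log R + 5) * ∑ j, expect p (fun x => dev p j f x ^ 2)
        + ∑ j, expect p (fun x => |dev p j f x|) ^ 2 / M := by
  have h := variance_avgList_le hp hp1 hR hpR hM f (List.finRange n)
  rw [← List.ofFn_eq_map, List.sum_ofFn, avgList_eq_expect hp1 List.mem_finRange,
    expect_const hp1] at h
  refine h.trans ?_
  have hlogR := Real.log_nonneg hR
  gcongr with j
  rw [sub_le_self_iff]
  exact Finset.sum_nonneg fun x _ =>
    mul_nonneg (prodW_nonneg (fun ω => (hp ω).le) x) (sq_nonneg _)

end Product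

section Indicator

variable {Ω : Type*} [Fintype Ω] {n : ℕ} {p : Ω → ℝ}

lemma expect_ind (A : Set (Fin n → Ω)) : expect p (ind A) = measOf p A := by
  simp only [expect, ind, measOf, Finset.sum_filter, mul_ite, mul_one, mul_zero]

lemma sum_le_pmed {B : Finset Ω} (hB : ∑ ω ∈ B, p ω ≤ 1 / 2) : ∑ ω ∈ B, p ω ≤ pmed p :=
  Finset.le_sup' (fun B => ∑ ω ∈ B, p ω) (by simpa using hB)

lemma exists_eq_pmed (p : Ω → ℝ) : ∃ B : Finset Ω, ∑ ω ∈ B, p ω ≤ 1 / 2 ∧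
    pmed p = ∑ ω ∈ B, p ω := by
  obtain ⟨B, hB, h⟩ := Finset.exists_mem_eq_sup'
    (s := Finset.univ.filter fun B : Finset Ω => ∑ ω ∈ B, p ω ≤ 1 / 2)
    ⟨∅, by simp⟩ (fun B => ∑ ω ∈ B, p ω)
  exact ⟨B, by simpa using hB, h⟩

lemma pmed_le_half (p : Ω → ℝ) : pmed p ≤ 1 / 2 := by
  obtain ⟨B, hB, h⟩ := exists_eq_pmed p
  rwa [h]

lemma mul_one_sub_le_pmed (hp : ∀ ω, 0 ≤ p ω) (hp1 : ∑ ω, p ω = 1) (B : Finset Ω) :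
    (∑ ω ∈ B, p ω) * (1 - ∑ ω ∈ B, p ω) ≤ pmed p := by
  have hc : ∑ ω ∈ Bᶜ, p ω = 1 - ∑ ω ∈ B, p ω := by
    rw [← hp1, ← Finset.sum_compl_add_sum B]; ring
  have h0 : 0 ≤ ∑ ω ∈ B, p ω := Finset.sum_nonneg fun ω _ => hp ω
  have h0' : 0 ≤ ∑ ω ∈ Bᶜ, p ω := Finset.sum_nonneg fun ω _ => hp ω
  rcases le_total (∑ ω ∈ B, p ω) (1 / 2) with h | h
  · have := sum_le_pmed h
    nlinarith
  · have := sum_le_pmed (p := p) (B := Bᶜ) (by linarith)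
    nlinarith

lemma avg_ind_mul_le (hp : ∀ ω, 0 ≤ p ω) (hp1 : ∑ ω, p ω = 1) (A : Set (Fin n → Ω)) (i : Fin n)
    (x : Fin n → Ω) :
    avg p i (ind A) x * (1 - avg p i (ind A) x) ≤ pmed p *
      if ∃ ξ ξ' : Ω, ind A (Function.update x i ξ) ≠ ind A (Function.update x i ξ')
        then 1 else 0 := by
  split_ifs with h
  · have e : avg p i (ind A) x
        = ∑ ω ∈ Finset.univ.filter (fun ω => Function.update x i ω ∈ A), p ω := by
      simp only [avg, ind, Finset.sum_filter, mul_ite, mul_one, mul_zero]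
    rw [e, mul_one]
    exact mul_one_sub_le_pmed hp hp1 _
  · push Not at h
    have e : avg p i (ind A) x = ind A x := by
      have : ∀ ω, ind A (Function.update x i ω) = ind A x := fun ω => by
        rw [h ω (x i), Function.update_eq_self]
      simp only [avg, this, ← Finset.sum_mul, hp1, one_mul]
    have h2 := ind_sq A x
    rw [e, mul_zero]
    nlinarith

lemma expect_avg_ind_mul_le (hp : ∀ ω, 0 ≤ p ω) (hp1 : ∑ ω, p ω = 1) (A : Set (Fin n → Ω))
    (i : Fin n) :
    expect p (fun x => avg p i (ind A) x * (1 - avg p i (ind A) x)) ≤ pmed p * IA p A i := by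
  refine (expect_mono hp (avg_ind_mul_le hp hp1 A i)).trans (le_of_eq ?_)
  rw [expect_const_mul]
  simp only [expect, IA, Finset.sum_filter, mul_ite, mul_one, mul_zero]

lemma expect_mul_one_sub (i : Fin n) (f : (Fin n → Ω) → ℝ) :
    expect p (fun x => avg p i f x * (1 - avg p i f x))
      = expect p (avg p i f) - expect p (fun x => avg p i f x ^ 2) := by
  rw [← expect_sub]
  exact congrArg _ (funext fun x => by ring)

lemma expect_sq_dev_ind (hp1 : ∑ ω, p ω = 1) (A : Set (Fin n → Ω)) (i : Fin n) :
    expect p (fun x => dev p i (ind A) x ^ 2)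
      = expect p (fun x => avg p i (ind A) x * (1 - avg p i (ind A) x)) := by
  rw [expect_mul_one_sub, expect_sq_dev hp1, expect_avg hp1]
  simp only [ind_sq]

lemma expect_abs_dev_ind (hp : ∀ ω, 0 ≤ p ω) (hp1 : ∑ ω, p ω = 1) (A : Set (Fin n → Ω))
    (i : Fin n) :
    expect p (fun x => |dev p i (ind A) x|)
      = 2 * expect p (fun x => avg p i (ind A) x * (1 - avg p i (ind A) x)) := by
  have hind : ∀ x, 0 ≤ ind A x ∧ ind A x ≤ 1 := fun x => by
    unfold ind
    split_ifs <;> norm_num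
  have e : ∀ x, |dev p i (ind A) x|
      = (ind A x + avg p i (ind A) x) - 2 * (ind A x * avg p i (ind A) x) := by
    intro x
    have h0 : 0 ≤ avg p i (ind A) x := avg_nonneg hp i (fun y => (hind y).1) x
    have h1 : avg p i (ind A) x ≤ 1 := by
      refine (avg_mono hp i (fun y => (hind y).2) x).trans (le_of_eq ?_)
      simp [avg, hp1]
    unfold dev
    by_cases hx : x ∈ A
    · have : ind A x = 1 := if_pos hx
      rw [this, abs_of_nonneg (by linarith)]
      ring
    · have : ind A x = 0 := if_neg hx
      rw [this, abs_of_nonpos (by linarith)]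
      ring
  simp only [e]
  rw [expect_sub, expect_const_mul, expect_mul_invariant hp1 i _ (avg_update i (ind A)),
    expect_mul_one_sub]
  have : expect p (fun x => ind A x + avg p i (ind A) x)
      = expect p (ind A) + expect p (avg p i (ind A)) := expect_add _ _
  rw [this, expect_avg hp1]
  simp only [pow_two]
  ring

end Indicator

end GenTalagrand

/-- **Corollary: generalized influence lower bound.** There is a universal constant
`C > 0` such that for each finite set `Ω`, each probability measure `μ` on `Ω` with
`p_min = min_ω μ({ω}) > 0` and `p_med > 0`, each `n ≥ 1`, and each set `A ⊆ Ωⁿ` with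
`0 < maxᵢ I_A(i)`, one has
`∑ᵢ I_A(i) ≥ C · [log(1/maxᵢ I_A(i)) / (p_med · log(1/p_min))] · μⁿ(A)(1 − μⁿ(A))`. -/
theorem gen_influence_lower_bound :
    ∃ C : ℝ, 0 < C ∧
      ∀ (Ω : Type) (_ : Fintype Ω) (_ : Nonempty Ω) (p : Ω → ℝ),
        (∀ ω, 0 < p ω) → (∑ ω, p ω = 1) → 0 < pmed p →
        ∀ (n : ℕ) (hn : 0 < n) (A : Set (Fin n → Ω)),
          0 < (Finset.univ.sup'
                (Finset.univ_nonempty_iff.mpr (Fin.pos_iff_nonempty.mp hn))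
                (fun i => IA p A i)) →
          ∑ i : Fin n, IA p A i ≥
            C * (Real.log (1 / Finset.univ.sup'
                    (Finset.univ_nonempty_iff.mpr (Fin.pos_iff_nonempty.mp hn))
                    (fun i => IA p A i)) /
                  (pmed p * Real.log (1 / Finset.univ.inf' Finset.univ_nonempty p))) *
              (measOf p A * (1 - measOf p A)) := by
  refine ⟨1 / 16, by norm_num, ?_⟩
  intro Ω _ _ p hp hp1 hmed n hn A hM
  have hp' : ∀ ω, 0 ≤ p ω := fun ω => (hp ω).le
  set M := Finset.univ.sup' (Finset.univ_nonempty_iff.mpr (Fin.pos_iff_nonempty.mp hn))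
    (fun i => IA p A i) with hMdef
  set q := Finset.univ.inf' Finset.univ_nonempty p with hq
  have hq0 : 0 < q := (Finset.lt_inf'_iff _).mpr fun ω _ => hp ω
  have hqle : ∀ ω, q ≤ p ω := fun ω => Finset.inf'_le p (Finset.mem_univ ω)
  have hq2 : q ≤ 1 / 2 := by
    obtain ⟨B, hB, hB'⟩ := exists_eq_pmed p
    obtain ⟨ω, hω⟩ : B.Nonempty := by
      rw [Finset.nonempty_iff_ne_empty]
      rintro rfl
      simp [hB'] at hmed
    exact (hqle ω).trans ((Finset.single_le_sum (fun ω _ => hp' ω) hω).trans hB)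
  have hR2 : 2 ≤ 1 / q := by
    rw [le_div_iff₀ hq0]
    linarith
  have hlog : 1 / 2 ≤ Real.log (1 / q) := by
    have h1 := Real.log_le_log (by norm_num) hR2
    have h2 := Real.log_two_gt_d9
    linarith
  have hpR : ∀ ω, 1 ≤ 1 / q * p ω := fun ω => by
    rw [one_div_mul_eq_div, le_div_iff₀ hq0, one_mul]
    exact hqle ω
  have hI : ∀ i, IA p A i ≤ M := fun i =>
    Finset.le_sup' (fun i => IA p A i) (Finset.mem_univ i)
  have hI0 : ∀ i, 0 ≤ IA p A i := fun i => Finset.sum_nonneg fun x _ => prodW_nonneg hp' x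
  have hmain := variance_mul_log_le hp hp1 (by linarith) hpR hM (ind A)
  have hsq : expect p (fun x => ind A x ^ 2) = measOf p A := by
    simp only [ind_sq]
    exact expect_ind A
  rw [hsq, expect_ind] at hmain
  set s : Fin n → ℝ := fun i =>
    expect p (fun x => avg p i (ind A) x * (1 - avg p i (ind A) x)) with hs
  have hs_le : ∀ i, s i ≤ pmed p * IA p A i := expect_avg_ind_mul_le hp' hp1 A
  have hs_eq : ∀ i, expect p (fun x => dev p i (ind A) x ^ 2) = s i := expect_sq_dev_ind hp1 A
  have ha_eq : ∀ i, expect p (fun x => |dev p i (ind A) x|) = 2 * s i :=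
    expect_abs_dev_ind hp' hp1 A
  have hs0 : ∀ i, 0 ≤ s i := fun i => by
    rw [← hs_eq]
    exact Finset.sum_nonneg fun x _ => mul_nonneg (prodW_nonneg hp' x) (sq_nonneg _)
  simp only [hs_eq, ha_eq] at hmain
  have hsmall : ∀ i, (2 * s i) ^ 2 / M ≤ 2 * s i := fun i => by
    rw [div_le_iff₀ hM, pow_two]
    refine mul_le_mul_of_nonneg_left ?_ (by linarith [hs0 i])
    nlinarith [hs_le i, pmed_le_half p, hI0 i, hI i]
  have hsum1 : ∑ i, (2 * s i) ^ 2 / M ≤ 2 * ∑ i, s i := by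
    rw [Finset.mul_sum]
    exact Finset.sum_le_sum fun i _ => hsmall i
  have hsum2 : ∑ i, s i ≤ pmed p * ∑ i, IA p A i := by
    rw [Finset.mul_sum]
    exact Finset.sum_le_sum fun i _ => hs_le i
  have hS0 : 0 ≤ ∑ i, s i := Finset.sum_nonneg fun i _ => hs0 i
  have hfin : (measOf p A - measOf p A ^ 2) * Real.log (1 / M)
      ≤ 16 * Real.log (1 / q) * (pmed p * ∑ i, IA p A i) :=
    calc _ ≤ (2 * Real.log (1 / q) + 7) * ∑ i, s i := by linarith
      _ ≤ 16 * Real.log (1 / q) * (pmed p * ∑ i, IA p A i) := by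
        gcongr
        linarith
  have hden : 0 < pmed p * Real.log (1 / q) := mul_pos hmed (by linarith)
  rw [ge_iff_le]
  have e : 1 / 16 * (Real.log (1 / M) / (pmed p * Real.log (1 / q)))
      * (measOf p A * (1 - measOf p A))
      = (measOf p A - measOf p A ^ 2) * Real.log (1 / M) / (16 * (pmed p * Real.log (1 / q))) := by
    field_simp
  rw [e, div_le_iff₀ (by positivity)]
  linarith
end
end
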